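/- arXiv:math/0311486 — 2 statements merged into one kernel-verified Lean document; each statement's English description precedes it below -/
import Mathlib

section
/- Singular-values-of-a-product problem for SL(3,ℂ) (root system A₂), arbitrary number of factors: Let n ≥ 3 and for each i ∈ {1,…,n} let (aᵢ, bᵢ, cᵢ) ∈ ℝ³ satisfy aᵢ ≥ bᵢ ≥ cᵢ and aᵢ + bᵢ + cᵢ = 0. Then there exist matrices A₁, …, Aₙ ∈ SL(3,ℂ) with A₁·A₂·…·Aₙ = 1 such that for each i the multiset of eigenvalues of the Hermitian matrix Aᵢ·Aᵢᴴ is {exp(2aᵢ), exp(2bᵢ), exp(2cᵢ)} (i.e. the logarithms of the singular values of Aᵢ are aᵢ, bᵢ, cᵢ), if and only if the following inequalities hold: (I) for every i: aᵢ + Σ_{j≠i} cⱼ ≤ 0; (II) for every pair i ≠ j: bᵢ + bⱼ + Σ_{k∉{i,j}} c_k ≤ 0; (III) for every i: cᵢ + Σ_{j≠i} aⱼ ≥ 0; (IV) for every pair i ≠ j: bᵢ + bⱼ + Σ_{k∉{i,j}} a_k ≥ 0. -/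
open Matrix Finset

namespace SingularValuesA2

open Polynomial in
/-- A Hermitian matrix is unitarily conjugate to any real diagonal matrix with the same
characteristic polynomial. -/
lemma exists_unitary_diagonalization {𝕜 n : Type*} [RCLike 𝕜] [Fintype n] [DecidableEq n]
    {H : Matrix n n 𝕜} (hH : H.IsHermitian) {d : n → ℝ}
    (hd : H.charpoly = ∏ j, (X - C (d j : 𝕜))) :
    ∃ U ∈ unitaryGroup n 𝕜, H = U * diagonal (fun j => (d j : 𝕜)) * star U := by
  have hD : (diagonal (fun j => (d j : 𝕜))).IsHermitian := by
    rw [IsHermitian, diagonal_conjTranspose]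
    congr 1
    ext j
    simp
  have hev : hH.eigenvalues = hD.eigenvalues := by
    rw [IsHermitian.eigenvalues_eq_eigenvalues_iff, hd, charpoly_diagonal]
  have h1 := hH.spectral_theorem
  have h2 := hD.spectral_theorem
  rw [Unitary.conjStarAlgAut_apply] at h1 h2
  set V := hH.eigenvectorUnitary
  set W := hD.eigenvectorUnitary
  refine ⟨(V * star W : unitaryGroup n 𝕜), SetLike.coe_mem _, ?_⟩
  have hW : star (W : Matrix n n 𝕜) * (W : Matrix n n 𝕜) = 1 := Unitary.coe_star_mul_self W
  have h3 : star (W : Matrix n n 𝕜) * diagonal (fun j => (d j : 𝕜)) * (W : Matrix n n 𝕜)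
      = diagonal (RCLike.ofReal ∘ hD.eigenvalues) := by
    conv_lhs => rw [h2]
    simp only [mul_assoc, hW, mul_one]
    rw [← mul_assoc, hW, one_mul]
  rw [h1, hev, ← h3]
  simp [mul_assoc]

/-- Two real tuples with the same multiset of values differ by a permutation. -/
lemma exists_perm_of_map_univ_eq {n : ℕ} {f g : Fin n → ℝ}
    (h : Multiset.map f univ.val = Multiset.map g univ.val) :
    ∃ σ : Equiv.Perm (Fin n), ∀ j, f (σ j) = g j := by
  have hp : (List.ofFn f).Perm (List.ofFn g) := by
    rw [← Multiset.coe_eq_coe, ← Fin.univ_val_map, ← Fin.univ_val_map, h]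
  have hs : List.ofFn (f ∘ Tuple.sort f) = List.ofFn (g ∘ Tuple.sort g) := by
    refine List.Perm.eq_of_sortedLE (Tuple.monotone_sort f).sortedLE_ofFn
      (Tuple.monotone_sort g).sortedLE_ofFn ?_
    exact ((Equiv.Perm.ofFn_comp_perm _ f).trans hp).trans (Equiv.Perm.ofFn_comp_perm _ g).symm
  rw [List.ofFn_inj] at hs
  refine ⟨(Tuple.sort g).symm.trans (Tuple.sort f), fun j => ?_⟩
  simpa using congrFun hs ((Tuple.sort g).symm j)

/-- The characteristic polynomial of a `3 × 3` matrix. -/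
lemma eval_charpoly_fin_three {R : Type*} [CommRing R] (N : Matrix (Fin 3) (Fin 3) R) (t : R) :
    N.charpoly.eval t = t ^ 3 - N.trace * t ^ 2 + N.adjugate.trace * t - N.det := by
  rw [eval_charpoly, adjugate_fin_three, det_fin_three, det_fin_three, trace_fin_three,
    trace_fin_three]
  simp
  ring

open Polynomial in
lemma charpoly_eq_prod_of_symm {R : Type*} [CommRing R] [IsDomain R] [Infinite R]
    (N : Matrix (Fin 3) (Fin 3) R) (d : Fin 3 → R)
    (h1 : N.trace = d 0 + d 1 + d 2)
    (h2 : N.adjugate.trace = d 0 * d 1 + d 0 * d 2 + d 1 * d 2)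
    (h3 : N.det = d 0 * d 1 * d 2) : N.charpoly = ∏ j, (X - C (d j)) := by
  refine Polynomial.funext fun t => ?_
  rw [eval_charpoly_fin_three, h1, h2, h3, eval_prod]
  simp [Fin.prod_univ_three]
  ring

/-- `HasSquaredSingularValues A z` says that `A ∈ SL(3, ℂ)` and that `A * Aᴴ` has eigenvalues
`z 0, z 1, z 2`. -/
def HasSquaredSingularValues (A : Matrix (Fin 3) (Fin 3) ℂ) (z : Fin 3 → ℝ) : Prop :=
  A.det = 1 ∧ (A * Aᴴ).charpoly = ∏ j, (Polynomial.X - Polynomial.C (z j : ℂ))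

lemma hasSquaredSingularValues_iff (A : Matrix (Fin 3) (Fin 3) ℂ) (z : Fin 3 → ℝ) :
    HasSquaredSingularValues A z ↔ A.det = 1 ∧ ∃ h : (A * Aᴴ).IsHermitian,
      ∃ σ : Equiv.Perm (Fin 3), ∀ j, h.eigenvalues (σ j) = z j := by
  refine and_congr_right fun _ => ⟨fun hc => ?_, ?_⟩
  · have h : (A * Aᴴ).IsHermitian := isHermitian_mul_conjTranspose_self A
    refine ⟨h, exists_perm_of_map_univ_eq ?_⟩
    have hr := h.roots_charpoly_eq_eigenvalues
    have hz : ∏ j, (Polynomial.X - Polynomial.C (z j : ℂ)) =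
        (((univ : Finset (Fin 3)).val.map fun j => (z j : ℂ)).map
          fun x => Polynomial.X - Polynomial.C x).prod := by
      rw [Multiset.map_map]
      rfl
    rw [hc, hz, Polynomial.roots_multiset_prod_X_sub_C] at hr
    refine Multiset.map_injective (f := fun x : ℝ => (x : ℂ)) Complex.ofReal_injective ?_
    rw [Multiset.map_map, Multiset.map_map]
    exact hr.symm
  · rintro ⟨h, σ, hσ⟩
    rw [h.charpoly_eq, ← Equiv.prod_comp σ]
    simp [hσ]


/-! ### Necessity of the inequalities -/

section Necessity

/-- The squared Euclidean norm on `ℂ³`. -/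
noncomputable def sqNorm (w : Fin 3 → ℂ) : ℝ := ∑ j, ‖w j‖ ^ 2

lemma ofReal_sqNorm (w : Fin 3 → ℂ) : (sqNorm w : ℂ) = w ⬝ᵥ star w := by
  simp [sqNorm, dotProduct, Complex.mul_conj']

lemma sqNorm_pos {w : Fin 3 → ℂ} (hw : w ≠ 0) : 0 < sqNorm w := by
  obtain ⟨j, hj⟩ := Function.ne_iff.1 hw
  exact Finset.sum_pos' (fun _ _ => by positivity) ⟨j, mem_univ j, by
    have : 0 < ‖w j‖ := norm_pos_iff.2 hj
    positivity⟩

lemma HasSquaredSingularValues.exists_unitary {A : Matrix (Fin 3) (Fin 3) ℂ} {z : Fin 3 → ℝ}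
    (h : HasSquaredSingularValues A z) : ∃ U : Matrix (Fin 3) (Fin 3) ℂ, ∀ w : Fin 3 → ℂ,
      sqNorm w = ∑ j, ‖(w ᵥ* U) j‖ ^ 2 ∧ sqNorm (w ᵥ* A) = ∑ j, z j * ‖(w ᵥ* U) j‖ ^ 2 := by
  obtain ⟨U, hU, hd⟩ :=
    exists_unitary_diagonalization (isHermitian_mul_conjTranspose_self A) h.2
  rw [mem_unitaryGroup_iff, star_eq_conjTranspose] at hU
  rw [star_eq_conjTranspose] at hd
  have key (B : Matrix (Fin 3) (Fin 3) ℂ) (w : Fin 3 → ℂ) :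
      (sqNorm (w ᵥ* B) : ℂ) = w ⬝ᵥ (B * Bᴴ) *ᵥ star w := by
    rw [ofReal_sqNorm, star_vecMul, ← dotProduct_mulVec, mulVec_mulVec]
  refine ⟨U, fun w => ⟨?_, ?_⟩⟩
  · rw [← sqNorm]
    apply Complex.ofReal_injective
    rw [key, hU, one_mulVec, ofReal_sqNorm]
  · apply Complex.ofReal_injective
    rw [key, hd, mul_assoc, ← mulVec_mulVec, dotProduct_mulVec, ← mulVec_mulVec, ← star_vecMul,
      dotProduct]
    push_cast
    refine Finset.sum_congr rfl fun j _ => ?_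
    rw [mulVec_diagonal, Pi.star_apply, ← Complex.mul_conj', starRingEnd_apply]
    exact mul_left_comm _ _ _

/-- Two linear conditions on a cyclic chain of vectors acted on by matrices with product `1`
are satisfied by a nonzero chain. -/
lemma exists_cyclic_chain {n : ℕ} (A : Fin n → Matrix (Fin 3) (Fin 3) ℂ)
    (hdet : ∀ i, (A i).det = 1) (hA : (List.ofFn A).prod = 1)
    (i₀ i₁ : Fin n) (u₀ u₁ : Fin 3 → ℂ) :
    ∃ w : ℕ → Fin 3 → ℂ, (∀ k, w k ≠ 0) ∧ w n = w 0 ∧ (∀ i : Fin n, w (i + 1) = w i ᵥ* A i) ∧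
      w i₀ ⬝ᵥ u₀ = 0 ∧ w i₁ ⬝ᵥ u₁ = 0 := by
  let P : ℕ → Matrix (Fin 3) (Fin 3) ℂ := fun k => ((List.ofFn A).take k).prod
  have hP : ∀ k, (P k).det = 1 := fun k => by
    have hsub : ∀ l : List (Matrix (Fin 3) (Fin 3) ℂ), (∀ B ∈ l, B.det = 1) → l.prod.det = 1 := by
      intro l hl
      induction l with
      | nil => simp
      | cons B l ih =>
        rw [List.prod_cons, det_mul, hl B (by simp), ih fun C hC => hl C (by simp [hC]), one_mul]
    refine hsub _ fun B hB => ?_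
    obtain ⟨i, rfl⟩ := (List.mem_ofFn' A B).1 (List.mem_of_mem_take hB)
    exact hdet i
  let L : (Fin 3 → ℂ) →ₗ[ℂ] (Fin 2 → ℂ) :=
    Matrix.mulVecLin !![(P i₀ *ᵥ u₀) 0, (P i₀ *ᵥ u₀) 1, (P i₀ *ᵥ u₀) 2;
      (P i₁ *ᵥ u₁) 0, (P i₁ *ᵥ u₁) 1, (P i₁ *ᵥ u₁) 2]
  have hL : LinearMap.ker L ≠ ⊥ := LinearMap.ker_ne_bot_of_finrank_lt (by simp)
  obtain ⟨v, hv, hv0⟩ := Submodule.exists_mem_ne_zero_of_ne_bot hL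
  have hv' : L v = 0 := hv
  refine ⟨fun k => v ᵥ* P k, fun k hk => hv0 ?_, ?_, fun i => ?_, ?_, ?_⟩
  · have hu : IsUnit (P k) := (isUnit_iff_isUnit_det _).2 (by rw [hP]; exact isUnit_one)
    exact vecMul_injective_of_isUnit hu (by simpa using hk)
  · have : (List.ofFn A).take n = List.ofFn A := List.take_of_length_le (by simp)
    simp [P, this, hA]
  · rw [vecMul_vecMul]
    have hi : (i : ℕ) < (List.ofFn A).length := by simp
    simp only [P]
    rw [List.prod_take_succ _ _ hi]
    simp
  · rw [← dotProduct_mulVec]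
    have := congrFun hv' 0
    simpa [L, dotProduct, Fin.sum_univ_three, mulVec, mul_comm] using this
  · rw [← dotProduct_mulVec]
    have := congrFun hv' 1
    simpa [L, dotProduct, Fin.sum_univ_three, mulVec, mul_comm] using this

variable {n : ℕ} {A : Fin n → Matrix (Fin 3) (Fin 3) ℂ} {z : Fin n → Fin 3 → ℝ}

lemma exists_cyclic_weights (hA : (List.ofFn A).prod = 1)
    (hz : ∀ i, HasSquaredSingularValues (A i) (z i)) (i₀ i₁ : Fin n) (j₀ j₁ : Fin 3) :
    ∃ p : Fin n → Fin 3 → ℝ, (∀ i j, 0 ≤ p i j) ∧ p i₀ j₀ = 0 ∧ p i₁ j₁ = 0 ∧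
      (∀ i, 0 < ∑ j, p i j) ∧ ∏ i, (∑ j, z i j * p i j) / ∑ j, p i j = 1 := by
  choose U hU using fun i => (hz i).exists_unitary
  obtain ⟨w, hw0, hwn, hw, h0, h1⟩ := exists_cyclic_chain A (fun i => (hz i).1) hA i₀ i₁
    (fun k => U i₀ k j₀) (fun k => U i₁ k j₁)
  refine ⟨fun i j => ‖(w i ᵥ* U i) j‖ ^ 2, fun i j => by positivity, ?_, ?_, fun i => ?_, ?_⟩
  · have : (w i₀ ᵥ* U i₀) j₀ = 0 := h0
    simp [this]
  · have : (w i₁ ᵥ* U i₁) j₁ = 0 := h1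
    simp [this]
  · rw [← (hU i _).1]
    exact sqNorm_pos (hw0 _)
  · have : ∀ i : Fin n, (∑ j, z i j * ‖(w i ᵥ* U i) j‖ ^ 2) / ∑ j, ‖(w i ᵥ* U i) j‖ ^ 2 =
        (fun k => sqNorm (w (k + 1)) / sqNorm (w k)) i := fun i => by
      simp only
      rw [← (hU i _).1, ← (hU i _).2, hw]
    rw [Finset.prod_congr rfl fun i _ => this i,
      Fin.prod_univ_eq_prod_range (fun k => sqNorm (w (k + 1)) / sqNorm (w k)),
      Finset.prod_range_induction _ (fun k => sqNorm (w k) / sqNorm (w 0))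
        (div_self (sqNorm_pos (hw0 0)).ne') n (fun k _ => ?_), hwn,
      div_self (sqNorm_pos (hw0 0)).ne']
    have := (sqNorm_pos (hw0 0)).ne'
    have := (sqNorm_pos (hw0 k)).ne'
    field_simp

lemma sum_nonpos_of_weights (hA : (List.ofFn A).prod = 1)
    (hz : ∀ i, HasSquaredSingularValues (A i) (z i)) (i₀ i₁ : Fin n) (j₀ j₁ : Fin 3)
    (t : Fin n → ℝ) (ht : ∀ i, ∀ p : Fin 3 → ℝ, (∀ j, 0 ≤ p j) → (i = i₀ → p j₀ = 0) →
      (i = i₁ → p j₁ = 0) → Real.exp (2 * t i) * ∑ j, p j ≤ ∑ j, z i j * p j) :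
    ∑ i, t i ≤ 0 := by
  obtain ⟨p, hp, h0, h1, hpos, hprod⟩ := exists_cyclic_weights hA hz i₀ i₁ j₀ j₁
  have : ∏ i, Real.exp (2 * t i) ≤ 1 := by
    rw [← hprod]
    refine Finset.prod_le_prod (fun i _ => (Real.exp_pos _).le) fun i _ => ?_
    rw [le_div_iff₀ (hpos i)]
    exact ht i (p i) (hp i) (by rintro rfl; exact h0) (by rintro rfl; exact h1)
  rw [← Real.exp_sum, ← Finset.mul_sum, Real.exp_le_one_iff] at this
  linarith

lemma sum_nonneg_of_weights (hA : (List.ofFn A).prod = 1)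
    (hz : ∀ i, HasSquaredSingularValues (A i) (z i)) (hz0 : ∀ i j, 0 ≤ z i j)
    (i₀ i₁ : Fin n) (j₀ j₁ : Fin 3)
    (t : Fin n → ℝ) (ht : ∀ i, ∀ p : Fin 3 → ℝ, (∀ j, 0 ≤ p j) → (i = i₀ → p j₀ = 0) →
      (i = i₁ → p j₁ = 0) → ∑ j, z i j * p j ≤ Real.exp (2 * t i) * ∑ j, p j) :
    0 ≤ ∑ i, t i := by
  obtain ⟨p, hp, h0, h1, hpos, hprod⟩ := exists_cyclic_weights hA hz i₀ i₁ j₀ j₁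
  have : 1 ≤ ∏ i, Real.exp (2 * t i) := by
    rw [← hprod]
    refine Finset.prod_le_prod (fun i _ => div_nonneg
      (Finset.sum_nonneg fun j _ => mul_nonneg (hz0 i j) (hp i j)) (hpos i).le) fun i _ => ?_
    rw [div_le_iff₀ (hpos i)]
    exact ht i (p i) (hp i) (by rintro rfl; exact h0) (by rintro rfl; exact h1)
  rw [← Real.exp_sum, ← Finset.mul_sum, Real.one_le_exp_iff] at this
  linarith

end Necessity

/-- The stability inequalities. -/
structure StabilityIneqs {n : ℕ} (a b c : Fin n → ℝ) : Prop where
  top (i) : a i - c i + ∑ j, c j ≤ 0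
  mid (i j) : i ≠ j → (b i - c i) + (b j - c j) + ∑ k, c k ≤ 0
  bot (i) : 0 ≤ c i - a i + ∑ j, a j
  mid' (i j) : i ≠ j → 0 ≤ (b i - a i) + (b j - a j) + ∑ k, a k

lemma stabilityIneqs_of_prod_eq_one {n : ℕ} {a b c : Fin n → ℝ}
    (hab : ∀ i, b i ≤ a i) (hbc : ∀ i, c i ≤ b i)
    {A : Fin n → Matrix (Fin 3) (Fin 3) ℂ} (hA : (List.ofFn A).prod = 1)
    (hz : ∀ i, HasSquaredSingularValues (A i)
      ![Real.exp (2 * a i), Real.exp (2 * b i), Real.exp (2 * c i)]) :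
    StabilityIneqs a b c := by
  have eab : ∀ i, Real.exp (2 * b i) ≤ Real.exp (2 * a i) := fun i =>
    Real.exp_le_exp.2 (by linarith [hab i])
  have ebc : ∀ i, Real.exp (2 * c i) ≤ Real.exp (2 * b i) := fun i =>
    Real.exp_le_exp.2 (by linarith [hbc i])
  have hz0 : ∀ i j, 0 ≤ (![Real.exp (2 * a i), Real.exp (2 * b i), Real.exp (2 * c i)] :
      Fin 3 → ℝ) j := fun i j => by
    fin_cases j <;> simp [Real.exp_nonneg]
  constructor
  · intro i
    have := sum_nonpos_of_weights hA hz i i 1 2 (c + Pi.single i (a i - c i)) ?_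
    · simp [Finset.sum_add_distrib] at this
      linarith
    intro k p hp h0 h1
    simp only [Fin.sum_univ_three, Pi.add_apply]
    obtain rfl | hk := eq_or_ne k i
    · simp [h0 rfl, h1 rfl]
    · simp [hk]
      nlinarith [hp 0, hp 1, hp 2, eab k, ebc k]
  · intro i j hij
    have := sum_nonpos_of_weights hA hz i j 2 2
      (c + Pi.single i (b i - c i) + Pi.single j (b j - c j)) ?_
    · simp [Finset.sum_add_distrib] at this
      linarith
    intro k p hp h0 h1
    simp only [Fin.sum_univ_three, Pi.add_apply]
    obtain rfl | hk := eq_or_ne k i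
    · simp [h0 rfl, hij]
      nlinarith [hp 0, hp 1, eab k]
    obtain rfl | hk' := eq_or_ne k j
    · simp [h1 rfl, hk]
      nlinarith [hp 0, hp 1, eab k]
    · simp [hk, hk']
      nlinarith [hp 0, hp 1, hp 2, eab k, ebc k]
  · intro i
    have := sum_nonneg_of_weights hA hz hz0 i i 0 1 (a + Pi.single i (c i - a i)) ?_
    · simp [Finset.sum_add_distrib] at this
      linarith
    intro k p hp h0 h1
    simp only [Fin.sum_univ_three, Pi.add_apply]
    obtain rfl | hk := eq_or_ne k i
    · simp [h0 rfl, h1 rfl]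
    · simp [hk]
      nlinarith [hp 0, hp 1, hp 2, eab k, ebc k]
  · intro i j hij
    have := sum_nonneg_of_weights hA hz hz0 i j 0 0
      (a + Pi.single i (b i - a i) + Pi.single j (b j - a j)) ?_
    · simp [Finset.sum_add_distrib] at this
      linarith
    intro k p hp h0 h1
    simp only [Fin.sum_univ_three, Pi.add_apply]
    obtain rfl | hk := eq_or_ne k i
    · simp [h0 rfl, hij]
      nlinarith [hp 1, hp 2, ebc k]
    obtain rfl | hk' := eq_or_ne k j
    · simp [h1 rfl, hk]
      nlinarith [hp 1, hp 2, ebc k]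
    · simp [hk, hk']
      nlinarith [hp 0, hp 1, hp 2, eab k, ebc k]

/-! ### Unistochastic matrices of size three -/

section Unistochastic

/-- Sixteen times the squared area of the triangle with side lengths `√(P 0 k * P 1 k)`. -/
def triangleDefect (P : Matrix (Fin 3) (Fin 3) ℝ) : ℝ :=
  (∑ k, P 0 k * P 1 k) ^ 2 - 2 * ∑ k, (P 0 k * P 1 k) ^ 2

/-- The `3 × 3` unistochastic matrices, described by the triangle condition. -/
def unistochastic : Set (Matrix (Fin 3) (Fin 3) ℝ) :=
  {P | P ∈ doublyStochastic ℝ (Fin 3) ∧ 0 ≤ triangleDefect P}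

lemma isCompact_unistochastic : IsCompact unistochastic := by
  have hK : IsCompact (Set.univ.pi fun _ : Fin 3 => Set.univ.pi fun _ : Fin 3 =>
      Set.Icc (0 : ℝ) 1) := isCompact_univ_pi fun _ => isCompact_univ_pi fun _ => isCompact_Icc
  refine hK.of_isClosed_subset ?_ ?_
  · have h : unistochastic = {P : Matrix (Fin 3) (Fin 3) ℝ | (∀ i j, 0 ≤ P i j) ∧
        (∀ i, ∑ j, P i j = 1) ∧ (∀ j, ∑ i, P i j = 1) ∧ 0 ≤ triangleDefect P} := by
      ext P
      simp only [unistochastic, mem_doublyStochastic_iff_sum, Set.mem_ofPred_eq, and_assoc]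
    rw [h]
    simp only [Set.ofPred_and, Set.ofPred_forall, triangleDefect]
    have hc : ∀ i j, Continuous fun P : Matrix (Fin 3) (Fin 3) ℝ => P i j :=
      fun i j => continuous_id.matrix_elem i j
    refine IsClosed.inter ?_ (IsClosed.inter ?_ (IsClosed.inter ?_ ?_))
    · exact isClosed_iInter fun i => isClosed_iInter fun j =>
        isClosed_le continuous_const (hc i j)
    · exact isClosed_iInter fun i => isClosed_eq (by fun_prop) continuous_const
    · exact isClosed_iInter fun j => isClosed_eq (by fun_prop) continuous_const
    · exact isClosed_le continuous_const (by fun_prop)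
  · intro P hP i _ j _
    exact ⟨nonneg_of_mem_doublyStochastic hP.1, le_one_of_mem_doublyStochastic hP.1⟩

/-- The unistochastic matrices are star-shaped around the flat matrix. -/
lemma starConvex_unistochastic : StarConvex ℝ (of fun _ _ => 1 / 3) unistochastic := by
  rw [starConvex_iff_forall_pos]
  · intro P hP r s hr hs hrs
    obtain ⟨hP, hT⟩ := hP
    refine ⟨convex_doublyStochastic ?_ hP hr.le hs.le hrs, ?_⟩
    · rw [SetLike.mem_coe, mem_doublyStochastic_iff_sum]
      simp
    obtain ⟨h0, h1, h2⟩ := mem_doublyStochastic_iff_sum.1 hP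
    have hle : ∀ i j, P i j ≤ 1 := fun i j => le_one_of_mem_doublyStochastic hP
    obtain rfl : r = 1 - s := by linarith
    have r0 := h1 0
    have r1 := h1 1
    have c0 := h2 0
    have c1 := h2 1
    have c2 := h2 2
    have hsq : ∀ i j, P i j ^ 2 ≤ P i j := fun i j => by nlinarith [h0 i j, hle i j]
    have hN : 0 ≤ 3 - ∑ i, ∑ j, P i j ^ 2 := by
      have : ∑ i, ∑ j, P i j ^ 2 ≤ ∑ i, ∑ j, P i j :=
        Finset.sum_le_sum fun i _ => Finset.sum_le_sum fun j _ => hsq i j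
      simp [h1] at this
      linarith
    have hK : 0 ≤ ∑ k, P 0 k * P 1 k * P 2 k :=
      Finset.sum_nonneg fun k _ => mul_nonneg (mul_nonneg (h0 _ _) (h0 _ _)) (h0 _ _)
    have key : triangleDefect ((1 - s) • (of fun _ _ => 1 / 3) + s • P) =
        s ^ 4 * triangleDefect P + (1 - s) * (s ^ 3 * (4 / 3 * ∑ k, P 0 k * P 1 k * P 2 k) +
          (1 - s) * ((1 - s) * (1 + 3 * s) / 27 +
            s ^ 2 * (1 / 9 * (3 - ∑ i, ∑ j, P i j ^ 2)))) := by
      simp only [Fin.sum_univ_three] at *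
      have e02 : P 0 2 = 1 - P 0 0 - P 0 1 := by linarith
      have e12 : P 1 2 = 1 - P 1 0 - P 1 1 := by linarith
      have e20 : P 2 0 = 1 - P 0 0 - P 1 0 := by linarith
      have e21 : P 2 1 = 1 - P 0 1 - P 1 1 := by linarith
      have e22 : P 2 2 = P 0 0 + P 0 1 + P 1 0 + P 1 1 - 1 := by linarith
      simp only [triangleDefect, Fin.sum_univ_three, Matrix.add_apply, Matrix.smul_apply, of_apply,
        smul_eq_mul,
        e02, e12, e20, e21, e22]
      ring
    rw [key]
    positivity
  · refine ⟨?_, ?_⟩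
    · rw [mem_doublyStochastic_iff_sum]
      simp
    · simp [triangleDefect]
      norm_num

lemma exists_norm_eq_one_add_eq_zero (w : ℂ) : ∃ u : ℂ, ‖u‖ = 1 ∧ w + ‖w‖ * u = 0 := by
  obtain rfl | hw := eq_or_ne w 0
  · exact ⟨1, by simp⟩
  · have : (‖w‖ : ℂ) ≠ 0 := by simpa using hw
    refine ⟨-w / ‖w‖, by simp [hw], by field_simp; ring⟩

lemma exists_closed_triangle {r s t : ℝ} (hr : 0 ≤ r) (hs : 0 ≤ s) (ht : 0 ≤ t)
    (h : 0 ≤ (r ^ 2 + s ^ 2 + t ^ 2) ^ 2 - 2 * (r ^ 4 + s ^ 4 + t ^ 4)) :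
    ∃ u v : ℂ, ‖u‖ = 1 ∧ ‖v‖ = 1 ∧ r + s * u + t * v = 0 := by
  obtain ⟨u, hu, hw⟩ : ∃ u : ℂ, ‖u‖ = 1 ∧ ‖r + s * u‖ = t := by
    suffices ∃ p q : ℝ, p ^ 2 + q ^ 2 = 1 ∧ r ^ 2 + s ^ 2 + 2 * r * s * p = t ^ 2 by
      obtain ⟨p, q, hpq, hp⟩ := this
      refine ⟨⟨p, q⟩, ?_, ?_⟩
      · rw [Complex.norm_eq_sqrt_sq_add_sq, hpq, Real.sqrt_one]
      · rw [Complex.norm_eq_sqrt_sq_add_sq, ← Real.sqrt_sq ht]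
        congr 1
        simp
        linear_combination hp + s ^ 2 * hpq
    obtain h0 | h0 := eq_or_ne (r * s) 0
    · refine ⟨1, 0, by norm_num, ?_⟩
      have : (t ^ 2 - r ^ 2 - s ^ 2) ^ 2 = 0 := by
        refine le_antisymm ?_ (sq_nonneg _)
        linear_combination h + 4 * r * s * h0
      linear_combination 2 * h0 - (pow_eq_zero_iff two_ne_zero).1 this
    · have hr0 := left_ne_zero_of_mul h0
      have hs0 := right_ne_zero_of_mul h0
      refine ⟨(t ^ 2 - r ^ 2 - s ^ 2) / (2 * (r * s)),
        √(1 - ((t ^ 2 - r ^ 2 - s ^ 2) / (2 * (r * s))) ^ 2), ?_, by field_simp; ring⟩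
      rw [Real.sq_sqrt]
      · ring
      · rw [div_pow, sub_nonneg, div_le_one (by positivity)]
        linear_combination h
  obtain ⟨v, hv, hv'⟩ := exists_norm_eq_one_add_eq_zero (r + s * u)
  exact ⟨u, v, hu, hv, by rw [← hw]; exact hv'⟩

/-- The triangle condition characterizes unistochasticity. -/
lemma exists_unitary_of_mem_unistochastic {P : Matrix (Fin 3) (Fin 3) ℝ}
    (hP : P ∈ unistochastic) : ∃ U : Matrix (Fin 3) (Fin 3) ℂ,
      U * Uᴴ = 1 ∧ U.det = 1 ∧ ∀ i j, ‖U i j‖ ^ 2 = P i j := by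
  obtain ⟨hP, hT⟩ := hP
  obtain ⟨h0, h1, h2⟩ := mem_doublyStochastic_iff_sum.1 hP
  have hs : ∀ k, √(P 0 k * P 1 k) ^ 2 = P 0 k * P 1 k := fun k =>
    Real.sq_sqrt (mul_nonneg (h0 _ _) (h0 _ _))
  obtain ⟨u, v, hu, hv, huv⟩ := exists_closed_triangle (Real.sqrt_nonneg (P 0 0 * P 1 0))
    (Real.sqrt_nonneg (P 0 1 * P 1 1)) (Real.sqrt_nonneg (P 0 2 * P 1 2)) (by
      have h4 : ∀ k, √(P 0 k * P 1 k) ^ 4 = (P 0 k * P 1 k) ^ 2 := fun k => by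
        rw [show √(P 0 k * P 1 k) ^ 4 = (√(P 0 k * P 1 k) ^ 2) ^ 2 by ring, hs]
      rw [hs, hs, hs, h4, h4, h4]
      simpa [triangleDefect, Fin.sum_univ_three] using hT)
  let φ : Fin 3 → ℂ := ![1, u, v]
  have hφ : ∀ k, ‖φ k‖ = 1 := by
    intro k
    fin_cases k <;> simp [φ, hu, hv]
  let p : Fin 3 → ℂ := fun k => (√(P 0 k) : ℝ)
  let q : Fin 3 → ℂ := fun k => (√(P 1 k) : ℝ) * φ k
  have hpn : ∀ k, ‖p k‖ ^ 2 = P 0 k := fun k => by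
    simp [p, Real.sq_sqrt (h0 _ _)]
  have hqn : ∀ k, ‖q k‖ ^ 2 = P 1 k := fun k => by
    simp [q, hφ, Real.sq_sqrt (h0 _ _)]
  have hself : ∀ w : Fin 3 → ℂ, w ⬝ᵥ star w = ((∑ k, ‖w k‖ ^ 2 : ℝ) : ℂ) := fun w => by
    simp [dotProduct, Complex.mul_conj']
  have hpp : p ⬝ᵥ star p = 1 := by
    rw [hself]
    simp only [hpn, h1, Complex.ofReal_one]
  have hqq : q ⬝ᵥ star q = 1 := by
    rw [hself]
    simp only [hqn, h1, Complex.ofReal_one]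
  have hps : star p = p := by
    ext k
    simp [p]
  have hpq : p ⬝ᵥ q = 0 := by
    rw [← huv]
    simp only [dotProduct, Fin.sum_univ_three, p, q, φ, Real.sqrt_mul (h0 _ _)]
    simp
    ring
  have hqp : q ⬝ᵥ star p = 0 := by rw [hps, dotProduct_comm, hpq]
  have hpq' : p ⬝ᵥ star q = 0 := by
    rw [← hps, star_dotProduct_star, dotProduct_comm, hpq, star_zero]
  have hcs : star (p ⨯₃ q) = star p ⨯₃ star q := by
    ext k
    fin_cases k <;> simp [cross_apply]
  have hcc : (p ⨯₃ q) ⬝ᵥ (star p ⨯₃ star q) = 1 := by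
    rw [cross_dot_cross, hpp, hqq, hpq', hqp]
    simp
  let U : Matrix (Fin 3) (Fin 3) ℂ := of ![p, q, star p ⨯₃ star q]
  have hrow : ∀ i j, (U * Uᴴ) i j = U i ⬝ᵥ star (U j) := fun i j => rfl
  have hstar : star (star p ⨯₃ star q) = p ⨯₃ q := by rw [← hcs, star_star]
  have hU : U * Uᴴ = 1 := by
    ext i j
    rw [hrow]
    fin_cases i <;> fin_cases j
    · exact hpp
    · exact hpq'
    · change p ⬝ᵥ star (star p ⨯₃ star q) = 0
      rw [hstar, dot_self_cross]
    · exact hqp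
    · exact hqq
    · change q ⬝ᵥ star (star p ⨯₃ star q) = 0
      rw [hstar, dot_cross_self]
    · change (star p ⨯₃ star q) ⬝ᵥ star p = 0
      rw [dotProduct_comm, dot_self_cross]
    · change (star p ⨯₃ star q) ⬝ᵥ star q = 0
      rw [dotProduct_comm, dot_cross_self]
    · change (star p ⨯₃ star q) ⬝ᵥ star (star p ⨯₃ star q) = 1
      rw [hstar, dotProduct_comm, hcc]
  refine ⟨U, hU, ?_, ?_⟩
  · have : U = ![p, q, star p ⨯₃ star q] := rfl
    rw [this, ← triple_product_eq_det, triple_product_permutation, triple_product_permutation,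
      dotProduct_comm, hcc]
  · have hU' : Uᴴ * U = 1 := mul_eq_one_comm.1 hU
    have hcol : ∀ k, ‖U 0 k‖ ^ 2 + ‖U 1 k‖ ^ 2 + ‖U 2 k‖ ^ 2 = 1 := fun k => by
      have := congrFun (congrFun hU' k) k
      rw [mul_apply, Fin.sum_univ_three] at this
      simp only [conjTranspose_apply, one_apply_eq, ← starRingEnd_apply, Complex.conj_mul'] at this
      exact_mod_cast this
    have e0 : ∀ k, ‖U 0 k‖ ^ 2 = P 0 k := hpn
    have e1 : ∀ k, ‖U 1 k‖ ^ 2 = P 1 k := hqn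
    intro i j
    have := hcol j
    have hc := h2 j
    rw [Fin.sum_univ_three] at hc
    fin_cases i
    · exact e0 j
    · exact e1 j
    · rw [e0, e1] at this
      change ‖U 2 j‖ ^ 2 = P 2 j
      linarith

/-- Orthostochastic matrices are unistochastic. -/
lemma mem_unistochastic_of_orthogonal {O : Matrix (Fin 3) (Fin 3) ℝ} (hO : O * Oᵀ = 1) :
    (of fun i j => O i j ^ 2) ∈ unistochastic := by
  have hO' : Oᵀ * O = 1 := mul_eq_one_comm.1 hO
  refine ⟨mem_doublyStochastic_iff_sum.2 ⟨fun i j => sq_nonneg _, fun i => ?_, fun j => ?_⟩, ?_⟩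
  · have := congrFun (congrFun hO i) i
    simpa [mul_apply, sq] using this
  · have := congrFun (congrFun hO' j) j
    simpa [mul_apply, sq] using this
  · have h01 := congrFun (congrFun hO 0) 1
    simp [mul_apply, Fin.sum_univ_three] at h01
    refine le_of_eq ?_
    simp only [triangleDefect, of_apply, Fin.sum_univ_three]
    linear_combination (O 0 0 * O 1 0 + O 0 1 * O 1 1 - O 0 2 * O 1 2) *
      (O 0 0 * O 1 0 - O 0 1 * O 1 1 + O 0 2 * O 1 2) *
      (-O 0 0 * O 1 0 + O 0 1 * O 1 1 + O 0 2 * O 1 2) * (-h01)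

end Unistochastic

/-! ### Pairings of spectra along unistochastic matrices -/

section Pairing

/-- The value `∑ i j, x i * y j * P i j`. -/
def pairing (x y : Fin 3 → ℝ) (P : Matrix (Fin 3) (Fin 3) ℝ) : ℝ :=
  ∑ i, ∑ j, x i * y j * P i j

/-- The pairings of `(x, y)` and `(x⁻¹, y⁻¹)` along a common unistochastic matrix are `p, q`. -/
def Attains (x y : Fin 3 → ℝ) (p q : ℝ) : Prop :=
  ∃ P ∈ unistochastic, pairing x y P = p ∧ pairing x⁻¹ y⁻¹ P = q

lemma pairing_convexCombination (x y : Fin 3 → ℝ) (r s : ℝ) (P Q : Matrix (Fin 3) (Fin 3) ℝ) :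
    pairing x y (r • P + s • Q) = r * pairing x y P + s * pairing x y Q := by
  simp only [pairing, Fin.sum_univ_three, Matrix.add_apply, Matrix.smul_apply, smul_eq_mul]
  ring

lemma pairing_flat (x y : Fin 3 → ℝ) :
    pairing x y (of fun _ _ => 1 / 3) = (∑ i, x i) * (∑ j, y j) / 3 := by
  simp only [pairing, Fin.sum_univ_three, of_apply]
  ring

/-- The attained values form a star-shaped set. -/
lemma Attains.convexCombination {x y : Fin 3 → ℝ} {p q t : ℝ} (h : Attains x y p q)
    (ht0 : 0 ≤ t) (ht1 : t ≤ 1) :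
    Attains x y ((1 - t) * ((∑ i, x i) * (∑ j, y j) / 3) + t * p)
      ((1 - t) * ((∑ i, x⁻¹ i) * (∑ j, y⁻¹ j) / 3) + t * q) := by
  obtain ⟨P, hP, rfl, rfl⟩ := h
  exact ⟨_, starConvex_unistochastic hP (sub_nonneg.2 ht1) ht0 (by ring),
    by rw [pairing_convexCombination, pairing_flat], by rw [pairing_convexCombination, pairing_flat]⟩

lemma attains_of_orthogonal {O : Matrix (Fin 3) (Fin 3) ℝ} (hO : O * Oᵀ = 1) (x y : Fin 3 → ℝ) :
    Attains x y (∑ i, ∑ j, x i * y j * O i j ^ 2) (∑ i, ∑ j, x⁻¹ i * y⁻¹ j * O i j ^ 2) :=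
  ⟨_, mem_unistochastic_of_orthogonal hO, rfl, rfl⟩

/-- Values attained by block rotations which fix the pairing of `x i` with `y j`. -/
lemma attains_of_blockRotation (x y : Fin 3 → ℝ) (i j : Fin 3) {t : ℝ} (ht0 : 0 ≤ t)
    (ht1 : t ≤ 1) :
    Attains x y
      (x i * y j + t * (x (i.succAbove 0) * y (j.succAbove 0) + x (i.succAbove 1) * y (j.succAbove 1))
        + (1 - t) * (x (i.succAbove 0) * y (j.succAbove 1) + x (i.succAbove 1) * y (j.succAbove 0)))
      (x⁻¹ i * y⁻¹ j +
        t * (x⁻¹ (i.succAbove 0) * y⁻¹ (j.succAbove 0) + x⁻¹ (i.succAbove 1) * y⁻¹ (j.succAbove 1))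
        + (1 - t) *
          (x⁻¹ (i.succAbove 0) * y⁻¹ (j.succAbove 1) + x⁻¹ (i.succAbove 1) * y⁻¹ (j.succAbove 0))) := by
  have ht : √t ^ 2 = t := Real.sq_sqrt ht0
  have ht' : √(1 - t) ^ 2 = 1 - t := Real.sq_sqrt (sub_nonneg.2 ht1)
  let R : Matrix (Fin 3) (Fin 3) ℝ := !![1, 0, 0; 0, √t, √(1 - t); 0, -√(1 - t), √t]
  have hR : R * Rᵀ = 1 := by
    ext i j
    fin_cases i <;> fin_cases j <;> simp [R, mul_apply, Fin.sum_univ_three] <;> nlinarith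
  have hO : R.submatrix i.cycleRange j.cycleRange * (R.submatrix i.cycleRange j.cycleRange)ᵀ = 1 := by
    rw [transpose_submatrix, submatrix_mul_equiv, hR, submatrix_one_equiv]
  have hsum : ∀ x y : Fin 3 → ℝ,
      ∑ i', ∑ j', x i' * y j' * R.submatrix i.cycleRange j.cycleRange i' j' ^ 2 =
      x i * y j + t * (x (i.succAbove 0) * y (j.succAbove 0) + x (i.succAbove 1) * y (j.succAbove 1))
        + (1 - t) *
          (x (i.succAbove 0) * y (j.succAbove 1) + x (i.succAbove 1) * y (j.succAbove 0)) := by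
    intro x y
    rw [← i.cycleRange.symm.sum_comp]
    simp_rw [← j.cycleRange.symm.sum_comp (fun j' => _ * y j' * _)]
    simp only [submatrix_apply, Equiv.apply_symm_apply]
    simp only [Fin.sum_univ_succ, Fin.cycleRange_symm_zero, Fin.cycleRange_symm_succ]
    simp [R, ht, ht']
    ring
  have := attains_of_orthogonal hO x y
  rwa [hsum, hsum] at this

end Pairing

/-! ### The Horn inequalities for two factors -/

section Horn

/-- The Horn inequalities relating logarithmic singular values of two factors and the product. -/
structure IsHorn (l m a : Fin 3 → ℝ) : Prop where
  upper : ∀ i j k : Fin 3, (i : ℕ) + j = k → a k ≤ l i + m j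
  lower : ∀ i j k : Fin 3, (i : ℕ) + j = k + 2 → l i + m j ≤ a k

/-- Decreasing vectors with sum zero. -/
structure IsDominant (v : Fin 3 → ℝ) : Prop where
  le01 : v 1 ≤ v 0
  le12 : v 2 ≤ v 1
  sum_eq : v 0 + v 1 + v 2 = 0

/-- The elementary symmetric functions of `exp ∘ a` are attained for `exp ∘ l` and `exp ∘ m`. -/
def ExpAttains (l m a : Fin 3 → ℝ) : Prop :=
  Attains (fun i => Real.exp (l i)) (fun i => Real.exp (m i))
    (∑ k, Real.exp (a k)) (∑ k, Real.exp (-a k))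

lemma exp_add_exp_le {p q r s : ℝ} (h : p + q = r + s) (hp : p ≤ r) (hq : q ≤ r) :
    Real.exp p + Real.exp q ≤ Real.exp r + Real.exp s := by
  have h1 : Real.exp p * Real.exp q = Real.exp r * Real.exp s := by
    rw [← Real.exp_add, ← Real.exp_add, h]
  have h2 := Real.exp_le_exp.2 hp
  have h3 := Real.exp_le_exp.2 hq
  have h4 := Real.exp_pos r
  have h5 : 0 ≤ (Real.exp r - Real.exp p) * (Real.exp r - Real.exp q) :=
    mul_nonneg (by linarith) (by linarith)
  nlinarith

lemma exp_add_exp_div {p q : ℝ} : Real.exp (-p) + Real.exp (-q) =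
    (Real.exp p + Real.exp q) * Real.exp (-(p + q)) := by
  rw [add_mul, ← Real.exp_add, ← Real.exp_add, add_comm]
  congr 2 <;> ring

/-- If one of the Horn inequalities is an equality then block rotations suffice. -/
lemma IsHorn.expAttains_of_eq {l m a : Fin 3 → ℝ} (h : IsHorn l m a) (hl : IsDominant l)
    (hm : IsDominant m) (ha : IsDominant a) {i j k : Fin 3}
    (hijk : (i : ℕ) + j = k ∨ (i : ℕ) + j = k + 2) (heq : a k = l i + m j) :
    ExpAttains l m a := by
  have s0 : (0 : Fin 3).succAbove 0 = 1 ∧ (0 : Fin 3).succAbove 1 = 2 := ⟨rfl, rfl⟩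
  have s1 : (1 : Fin 3).succAbove 0 = 0 ∧ (1 : Fin 3).succAbove 1 = 2 := ⟨rfl, rfl⟩
  have s2 : (2 : Fin 3).succAbove 0 = 0 ∧ (2 : Fin 3).succAbove 1 = 1 := ⟨rfl, rfl⟩
  obtain ⟨h1, h2, h3, h4⟩ : a (k.succAbove 0) ≤ l (i.succAbove 0) + m (j.succAbove 0) ∧
      l (i.succAbove 0) + m (j.succAbove 1) ≤ a (k.succAbove 0) ∧
      l (i.succAbove 1) + m (j.succAbove 0) ≤ a (k.succAbove 0) ∧
      a (k.succAbove 1) ≤ a (k.succAbove 0) := by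
    have u00 := h.upper 0 0 0 rfl
    have u01 := h.upper 0 1 1 rfl
    have u10 := h.upper 1 0 1 rfl
    have u02 := h.upper 0 2 2 rfl
    have u11 := h.upper 1 1 2 rfl
    have u20 := h.upper 2 0 2 rfl
    have l02 := h.lower 0 2 0 rfl
    have l11 := h.lower 1 1 0 rfl
    have l20 := h.lower 2 0 0 rfl
    have l12 := h.lower 1 2 1 rfl
    have l21 := h.lower 2 1 1 rfl
    have l22 := h.lower 2 2 2 rfl
    obtain ⟨hl1, hl2, hl3⟩ := hl
    obtain ⟨hm1, hm2, hm3⟩ := hm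
    obtain ⟨ha1, ha2, ha3⟩ := ha
    have hcases : (i = 0 ∧ j = 0 ∧ k = 0) ∨ (i = 0 ∧ j = 1 ∧ k = 1) ∨ (i = 1 ∧ j = 0 ∧ k = 1) ∨
        (i = 0 ∧ j = 2 ∧ k = 2) ∨ (i = 1 ∧ j = 1 ∧ k = 2) ∨ (i = 2 ∧ j = 0 ∧ k = 2) ∨
        (i = 0 ∧ j = 2 ∧ k = 0) ∨ (i = 1 ∧ j = 1 ∧ k = 0) ∨ (i = 2 ∧ j = 0 ∧ k = 0) ∨
        (i = 1 ∧ j = 2 ∧ k = 1) ∨ (i = 2 ∧ j = 1 ∧ k = 1) ∨ (i = 2 ∧ j = 2 ∧ k = 2) := by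
      clear * - hijk
      revert i j k
      decide
    rcases hcases with ⟨rfl, rfl, rfl⟩ | ⟨rfl, rfl, rfl⟩ | ⟨rfl, rfl, rfl⟩ | ⟨rfl, rfl, rfl⟩ |
      ⟨rfl, rfl, rfl⟩ | ⟨rfl, rfl, rfl⟩ | ⟨rfl, rfl, rfl⟩ | ⟨rfl, rfl, rfl⟩ | ⟨rfl, rfl, rfl⟩ |
      ⟨rfl, rfl, rfl⟩ | ⟨rfl, rfl, rfl⟩ | ⟨rfl, rfl, rfl⟩ <;>
    simp only [s0, s1, s2] <;> refine ⟨?_, ?_, ?_, ?_⟩ <;> linarith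
  have hsl := Fin.sum_univ_succAbove l i
  have hsm := Fin.sum_univ_succAbove m j
  have hsa := Fin.sum_univ_succAbove a k
  rw [Fin.sum_univ_three, hl.sum_eq, Fin.sum_univ_two] at hsl
  rw [Fin.sum_univ_three, hm.sum_eq, Fin.sum_univ_two] at hsm
  rw [Fin.sum_univ_three, ha.sum_eq, Fin.sum_univ_two] at hsa
  generalize hi0 : i.succAbove 0 = i0 at *
  generalize hi1 : i.succAbove 1 = i1 at *
  generalize hj0 : j.succAbove 0 = j0 at *
  generalize hj1 : j.succAbove 1 = j1 at *
  generalize hk0 : k.succAbove 0 = k0 at *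
  generalize hk1 : k.succAbove 1 = k1 at *
  have hle := exp_add_exp_le (p := a k0) (q := a k1) (r := l i0 + m j0) (s := l i1 + m j1)
    (by linarith) (by linarith) (by linarith)
  have hge := exp_add_exp_le (p := l i0 + m j1) (q := l i1 + m j0) (r := a k0) (s := a k1)
    (by linarith) (by linarith) (by linarith)
  obtain ⟨t, ⟨ht0, ht1⟩, ht⟩ : ∃ t ∈ Set.Icc (0 : ℝ) 1, Real.exp (a k0) + Real.exp (a k1) =
      t * (Real.exp (l i0 + m j0) + Real.exp (l i1 + m j1)) +
        (1 - t) * (Real.exp (l i0 + m j1) + Real.exp (l i1 + m j0)) := by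
    generalize Real.exp (a k0) + Real.exp (a k1) = z at *
    generalize Real.exp (l i0 + m j0) + Real.exp (l i1 + m j1) = w at *
    generalize Real.exp (l i0 + m j1) + Real.exp (l i1 + m j0) = v at *
    obtain h | h := eq_or_ne w v
    · exact ⟨0, by simp, by linarith⟩
    · have hvw : 0 < w - v := sub_pos.2 (lt_of_le_of_ne (hge.trans hle) h.symm)
      refine ⟨(z - v) / (w - v), ⟨div_nonneg (by linarith) hvw.le,
        (div_le_one hvw).2 (by linarith)⟩, ?_⟩
      field_simp
      ring
  have := attains_of_blockRotation (fun i => Real.exp (l i)) (fun i => Real.exp (m i)) i j ht0 ht1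
  rw [hi0, hi1, hj0, hj1] at this
  simp only [Pi.inv_apply, ← Real.exp_neg, ← Real.exp_add] at this
  unfold ExpAttains
  rw [Fin.sum_univ_succAbove _ k, Fin.sum_univ_succAbove (fun k => Real.exp (-a k)) k,
    Fin.sum_univ_two, Fin.sum_univ_two, hk0, hk1]
  convert this using 1
  · rw [ht, heq]
    ring
  · have e1 := exp_add_exp_div (p := a k0) (q := a k1)
    have e2 := exp_add_exp_div (p := l i0 + m j0) (q := l i1 + m j1)
    have e3 := exp_add_exp_div (p := l i0 + m j1) (q := l i1 + m j0)
    rw [show l i0 + m j0 + (l i1 + m j1) = a k0 + a k1 by linarith] at e2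
    rw [show l i0 + m j1 + (l i1 + m j0) = a k0 + a k1 by linarith] at e3
    simp only [← neg_add, e1, e2, e3, ht, heq]
    ring

/-- A symmetric rank one perturbation of a diagonal matrix with prescribed spectrum. -/
lemma attains_of_interlacing {x y r : Fin 3 → ℝ} {s : ℝ} (hs : 0 < s) (hx : ∀ i, 0 < x i)
    (hy : ∀ i, 0 < y i) (hxp : x 0 * x 1 * x 2 = 1) (hyp : y 0 * y 1 * y 2 = 1)
    (h01 : x 1 < x 0) (h12 : x 2 < x 1)
    (hr0 : r 0 = -((s / x 0 - y 0) * (s / x 0 - y 1) * (s / x 0 - y 2)) /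
      ((s / x 0 - s / x 1) * (s / x 0 - s / x 2)))
    (hr1 : r 1 = -((s / x 1 - y 0) * (s / x 1 - y 1) * (s / x 1 - y 2)) /
      ((s / x 1 - s / x 0) * (s / x 1 - s / x 2)))
    (hr2 : r 2 = -((s / x 2 - y 0) * (s / x 2 - y 1) * (s / x 2 - y 2)) /
      ((s / x 2 - s / x 0) * (s / x 2 - s / x 1)))
    (hr : (∀ i, 0 ≤ r i) ∨ ∀ i, r i ≤ 0) :
    Attains x y (2 * s + (s ^ 2)⁻¹) (2 * s⁻¹ + s ^ 2) := by
  obtain ⟨w, e, hw⟩ : ∃ (w : Fin 3 → ℝ) (e : ℝ), ∀ i, e * w i ^ 2 = r i := by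
    rcases hr with hr | hr
    · exact ⟨fun i => √(r i), 1, fun i => by rw [Real.sq_sqrt (hr i), one_mul]⟩
    · exact ⟨fun i => √(-r i), -1, fun i => by rw [Real.sq_sqrt (by linarith [hr i])]; ring⟩
  obtain ⟨k, hk⟩ : ∃ k : Fin 3 → ℝ, ∀ i, k i = s / x i := ⟨fun i => s / x i, fun i => rfl⟩
  simp only [← hk] at hr0 hr1 hr2
  have hx0 := hx 0
  have hx1 := hx 1
  have hx2 := hx 2
  have hk01 : k 0 - k 1 ≠ 0 := by
    rw [hk, hk]
    exact (sub_neg.2 (div_lt_div_of_pos_left hs hx1 h01)).ne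
  have hk12 : k 1 - k 2 ≠ 0 := by
    rw [hk, hk]
    exact (sub_neg.2 (div_lt_div_of_pos_left hs hx2 h12)).ne
  have hk02 : k 0 - k 2 ≠ 0 := by
    rw [hk, hk]
    exact (sub_neg.2 (div_lt_div_of_pos_left hs hx2 (h12.trans h01))).ne
  have hk10 : k 1 - k 0 ≠ 0 := by rwa [← neg_sub, neg_ne_zero]
  have hk21 : k 2 - k 1 ≠ 0 := by rwa [← neg_sub, neg_ne_zero]
  have hk20 : k 2 - k 0 ≠ 0 := by rwa [← neg_sub, neg_ne_zero]
  have hkp : k 0 * k 1 * k 2 = s ^ 3 := by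
    have : k 0 * k 1 * k 2 = s ^ 3 / (x 0 * x 1 * x 2) := by
      simp only [hk]
      field_simp
    rw [this, hxp, div_one]
  have q1 : r 0 + r 1 + r 2 = y 0 + y 1 + y 2 - (k 0 + k 1 + k 2) := by
    rw [hr0, hr1, hr2, ← neg_sub (k 0) (k 1), ← neg_sub (k 0) (k 2), ← neg_sub (k 1) (k 2)]
    field_simp
    ring
  have q2 : r 0 * (k 1 + k 2) + r 1 * (k 0 + k 2) + r 2 * (k 0 + k 1) =
      y 0 * y 1 + y 0 * y 2 + y 1 * y 2 - (k 0 * k 1 + k 0 * k 2 + k 1 * k 2) := by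
    rw [hr0, hr1, hr2, ← neg_sub (k 0) (k 1), ← neg_sub (k 0) (k 2), ← neg_sub (k 1) (k 2)]
    field_simp
    ring
  have q3 : r 0 * (k 1 * k 2) + r 1 * (k 0 * k 2) + r 2 * (k 0 * k 1) =
      y 0 * y 1 * y 2 - k 0 * k 1 * k 2 := by
    rw [hr0, hr1, hr2, ← neg_sub (k 0) (k 1), ← neg_sub (k 0) (k 2), ← neg_sub (k 1) (k 2)]
    field_simp
    ring
  let B : Matrix (Fin 3) (Fin 3) ℝ := diagonal k + of fun i j => e * (w i * w j)
  have hB : B.IsHermitian := by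
    ext i j
    by_cases h : i = j
    · simp [B, h]
    · simp [B, h, Ne.symm h, mul_comm]
  have hdet : B.det = 1 := by
    simp [B, det_fin_three]
    linear_combination q3 + hyp + (k 1 * k 2) * hw 0 + (k 0 * k 2) * hw 1 + (k 0 * k 1) * hw 2
  have hB' : B.charpoly = ∏ j, (Polynomial.X - Polynomial.C (y j)) := by
    refine charpoly_eq_prod_of_symm B y ?_ ?_ ?_
    · simp [B, trace_fin_three, Fin.sum_univ_three]
      linear_combination q1 + hw 0 + hw 1 + hw 2
    · simp [B, adjugate_fin_three, trace_fin_three]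
      linear_combination q2 + (k 1 + k 2) * hw 0 + (k 0 + k 2) * hw 1 + (k 0 + k 1) * hw 2
    · rw [hdet, hyp]
  obtain ⟨U, hU, hBU⟩ := exists_unitary_diagonalization (𝕜 := ℝ) hB (d := y) hB'
  have hU1 : U * Uᵀ = 1 := by
    simpa [star_eq_conjTranspose] using mem_unitaryGroup_iff.1 hU
  have hU2 : Uᵀ * U = 1 := mul_eq_one_comm.1 hU1
  have hBU' : B = U * diagonal y * Uᵀ := by
    simpa [star_eq_conjTranspose] using hBU
  have hadj : B.adjugate = U * diagonal y⁻¹ * Uᵀ := by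
    have h1 : B * B.adjugate = 1 := by rw [mul_adjugate, hdet, one_smul]
    have h2 : B * (U * diagonal y⁻¹ * Uᵀ) = 1 := by
      rw [hBU']
      calc U * diagonal y * Uᵀ * (U * diagonal y⁻¹ * Uᵀ)
          = U * diagonal y * (Uᵀ * U) * diagonal y⁻¹ * Uᵀ := by simp only [Matrix.mul_assoc]
        _ = 1 := by
          rw [hU2, Matrix.mul_one, Matrix.mul_assoc U, diagonal_mul_diagonal]
          simp [fun i => mul_inv_cancel₀ (hy i).ne', hU1]
    have h3 : B.adjugate * B = 1 := mul_eq_one_comm.1 h1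
    rw [← Matrix.mul_one B.adjugate, ← h2, ← Matrix.mul_assoc, h3, Matrix.one_mul]
  have hsum : ∀ (u v : Fin 3 → ℝ), ∑ i, ∑ j, u i * v j * U i j ^ 2 =
      ∑ i, u i * (U * diagonal v * Uᵀ) i i := by
    intro u v
    refine Finset.sum_congr rfl fun i _ => ?_
    rw [mul_apply, Finset.mul_sum]
    refine Finset.sum_congr rfl fun j _ => ?_
    rw [mul_diagonal, transpose_apply]
    ring
  have := attains_of_orthogonal hU1 x y
  rw [hsum, hsum, ← hBU', ← hadj] at this
  have hxk : ∀ i, x i * k i = s := fun i => by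
    rw [hk]
    field_simp [(hx i).ne']
  have hxk' : ∀ i, (x i)⁻¹ * s = k i := fun i => by
    rw [hk]
    field_simp
  convert this using 1
  · have e0 : x 0 * s ^ 2 = k 1 * k 2 := by
      rw [hk, hk]
      field_simp
      linear_combination hxp
    have e1 : x 1 * s ^ 2 = k 0 * k 2 := by
      rw [hk, hk]
      field_simp
      linear_combination hxp
    have e2 : x 2 * s ^ 2 = k 0 * k 1 := by
      rw [hk, hk]
      field_simp
      linear_combination hxp
    have hs2 : s ^ 2 ≠ 0 := by positivity
    refine mul_right_cancel₀ hs2 ?_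
    rw [add_mul, inv_mul_cancel₀ hs2]
    simp [B, Fin.sum_univ_three]
    linear_combination -s ^ 2 * (hxk 0 + hxk 1 + hxk 2) - r 0 * e0 - r 1 * e1 - r 2 * e2 - q3 +
      hkp - hyp - s ^ 2 * (x 0 * hw 0 + x 1 * hw 1 + x 2 * hw 2)
  · refine mul_right_cancel₀ hs.ne' ?_
    rw [add_mul, mul_assoc, inv_mul_cancel₀ hs.ne', Finset.sum_mul]
    simp_rw [mul_right_comm _ _ s, Pi.inv_apply, hxk']
    simp [B, adjugate_fin_three, Fin.sum_univ_three]
    linear_combination -2 * q3 - hkp - 2 * hyp - 2 * k 0 * k 1 * hw 2 -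
      2 * k 0 * k 2 * hw 1 - 2 * k 1 * k 2 * hw 0

/-- The case in which the product has a repeated singular value. -/
lemma IsHorn.expAttains_of_wall {l m a : Fin 3 → ℝ} (h : IsHorn l m a) (hl : IsDominant l)
    (hm : IsDominant m) (ha : IsDominant a) (h01 : l 1 < l 0) (h12 : l 2 < l 1)
    (hwall : a 0 = a 1 ∨ a 1 = a 2) : ExpAttains l m a := by
  have u01 := h.upper 0 1 1 rfl
  have u10 := h.upper 1 0 1 rfl
  have u02 := h.upper 0 2 2 rfl
  have u11 := h.upper 1 1 2 rfl
  have u20 := h.upper 2 0 2 rfl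
  have l02 := h.lower 0 2 0 rfl
  have l11 := h.lower 1 1 0 rfl
  have l20 := h.lower 2 0 0 rfl
  have l12 := h.lower 1 2 1 rfl
  have l21 := h.lower 2 1 1 rfl
  obtain ⟨hm1, hm2, hm3⟩ := hm
  have hk : ∀ i, Real.exp (a 1) / Real.exp (l i) = Real.exp (a 1 - l i) := fun i =>
    (Real.exp_sub _ _).symm
  have hle : ∀ {p q : ℝ}, p ≤ q → Real.exp p - Real.exp q ≤ 0 := fun h =>
    sub_nonpos.2 (Real.exp_le_exp.2 h)
  have hge : ∀ {p q : ℝ}, q ≤ p → 0 ≤ Real.exp p - Real.exp q := fun h =>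
    sub_nonneg.2 (Real.exp_le_exp.2 h)
  have k01 : a 1 - l 0 ≤ a 1 - l 1 := by linarith
  have k12 : a 1 - l 1 ≤ a 1 - l 2 := by linarith
  have d0 := mul_nonneg_of_nonpos_of_nonpos (hle k01) (hle (k01.trans k12))
  have d1 := mul_nonpos_of_nonneg_of_nonpos (hge k01) (hle k12)
  have d2 := mul_nonneg (hge (k01.trans k12)) (hge k12)
  have key := attains_of_interlacing (x := fun i => Real.exp (l i)) (y := fun i => Real.exp (m i))
    (r := ![_, _, _]) (s := Real.exp (a 1)) (Real.exp_pos _) (fun i => Real.exp_pos _)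
    (fun i => Real.exp_pos _) (by rw [← Real.exp_add, ← Real.exp_add, hl.sum_eq, Real.exp_zero])
    (by rw [← Real.exp_add, ← Real.exp_add, hm3, Real.exp_zero])
    (Real.exp_lt_exp.2 h01) (Real.exp_lt_exp.2 h12) rfl rfl rfl (by
      simp only [hk]
      rcases hwall with hw | hw
      · right
        have e0 := mul_nonneg (mul_nonneg_of_nonpos_of_nonpos
          (hle (show a 1 - l 0 ≤ m 0 by linarith)) (hle (show a 1 - l 0 ≤ m 1 by linarith)))
          (hge (show m 2 ≤ a 1 - l 0 by linarith))
        have e1 := mul_nonpos_of_nonpos_of_nonneg (mul_nonpos_of_nonpos_of_nonneg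
          (hle (show a 1 - l 1 ≤ m 0 by linarith)) (hge (show m 1 ≤ a 1 - l 1 by linarith)))
          (hge (show m 2 ≤ a 1 - l 1 by linarith))
        have e2 := mul_nonneg (mul_nonneg
          (hge (show m 0 ≤ a 1 - l 2 by linarith)) (hge (show m 1 ≤ a 1 - l 2 by linarith)))
          (hge (show m 2 ≤ a 1 - l 2 by linarith))
        intro i
        fin_cases i
        · exact div_nonpos_of_nonpos_of_nonneg (neg_nonpos.2 e0) d0
        · exact div_nonpos_of_nonneg_of_nonpos (neg_nonneg.2 e1) d1
        · exact div_nonpos_of_nonpos_of_nonneg (neg_nonpos.2 e2) d2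
      · left
        have e0 := mul_nonpos_of_nonneg_of_nonpos (mul_nonneg_of_nonpos_of_nonpos
          (hle (show a 1 - l 0 ≤ m 0 by linarith)) (hle (show a 1 - l 0 ≤ m 1 by linarith)))
          (hle (show a 1 - l 0 ≤ m 2 by linarith))
        have e1 := mul_nonneg (mul_nonneg_of_nonpos_of_nonpos
          (hle (show a 1 - l 1 ≤ m 0 by linarith)) (hle (show a 1 - l 1 ≤ m 1 by linarith)))
          (hge (show m 2 ≤ a 1 - l 1 by linarith))
        have e2 := mul_nonpos_of_nonpos_of_nonneg (mul_nonpos_of_nonpos_of_nonneg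
          (hle (show a 1 - l 2 ≤ m 0 by linarith)) (hge (show m 1 ≤ a 1 - l 2 by linarith)))
          (hge (show m 2 ≤ a 1 - l 2 by linarith))
        intro i
        fin_cases i
        · exact div_nonneg (neg_nonneg.2 e0) d0
        · exact div_nonneg_of_nonpos (neg_nonpos.2 e1) d1
        · exact div_nonneg (neg_nonneg.2 e2) d2)
  obtain ⟨ha1, ha2, ha3⟩ := ha
  have hsq : Real.exp (-(2 * a 1)) = (Real.exp (a 1) ^ 2)⁻¹ := by
    rw [Real.exp_neg, two_mul, Real.exp_add, sq]
  have hsq' : Real.exp (2 * a 1) = Real.exp (a 1) ^ 2 := by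
    rw [two_mul, Real.exp_add, sq]
  unfold ExpAttains
  convert key using 1
  · rw [Fin.sum_univ_three, ← hsq]
    rcases hwall with hw | hw
    · rw [hw, show a 2 = -(2 * a 1) by linarith]
      ring
    · rw [← hw, show a 0 = -(2 * a 1) by linarith]
      ring
  · rw [Fin.sum_univ_three, ← hsq', ← Real.exp_neg]
    rcases hwall with hw | hw
    · rw [hw, show -a 2 = 2 * a 1 by linarith]
      ring
    · rw [← hw, show -a 0 = 2 * a 1 by linarith]
      ring

end Horn

section Deformation

open Filter Topology

/-- Vectors with sum zero, parametrized by the first two coordinates. -/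
def traceless (s : ℝ × ℝ) : Fin 3 → ℝ := ![s.1, s.2, -s.1 - s.2]

/-- The first two elementary symmetric functions of the exponentials. -/
noncomputable def expSymm (s : ℝ × ℝ) : ℝ × ℝ :=
  (∑ k, Real.exp (traceless s k), ∑ k, Real.exp (-traceless s k))

lemma continuous_traceless (k : Fin 3) : Continuous fun s => traceless s k := by
  fin_cases k
  · exact continuous_fst
  · exact continuous_snd
  · exact continuous_fst.neg.sub continuous_snd

lemma continuous_expSymm : Continuous expSymm := by
  have := continuous_traceless
  unfold expSymm
  fun_prop

lemma traceless_sum (s : ℝ × ℝ) : traceless s 0 + traceless s 1 + traceless s 2 = 0 := by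
  simp [traceless]

lemma traceless_eq {a : Fin 3 → ℝ} (h : a 0 + a 1 + a 2 = 0) : traceless (a 0, a 1) = a := by
  ext k
  fin_cases k
  · rfl
  · rfl
  · change -a 0 - a 1 = a 2
    linarith

/-- The elementary symmetric functions are open maps at vectors with distinct entries. -/
lemma map_expSymm_nhds {s : ℝ × ℝ} (h01 : traceless s 1 < traceless s 0)
    (h12 : traceless s 2 < traceless s 1) : map expSymm (𝓝 s) = 𝓝 (expSymm s) := by
  let L : Fin 3 → ℝ × ℝ →L[ℝ] ℝ := ![ContinuousLinearMap.fst ℝ ℝ ℝ, ContinuousLinearMap.snd ℝ ℝ ℝ,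
    -ContinuousLinearMap.fst ℝ ℝ ℝ - ContinuousLinearMap.snd ℝ ℝ ℝ]
  have hL : ∀ k, HasStrictFDerivAt (fun s => traceless s k) (L k) s := by
    intro k
    fin_cases k
    · exact hasStrictFDerivAt_fst
    · exact hasStrictFDerivAt_snd
    · exact hasStrictFDerivAt_fst.neg.sub hasStrictFDerivAt_snd
  have hE : HasStrictFDerivAt expSymm
      ((∑ k, Real.exp (traceless s k) • L k).prod (∑ k, Real.exp (-traceless s k) • -L k)) s :=
    (HasStrictFDerivAt.fun_sum fun k _ => (hL k).exp).prodMk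
      (HasStrictFDerivAt.fun_sum fun k _ => (hL k).neg.exp)
  refine hE.map_nhds_eq_of_surj (LinearMap.range_eq_top.2 ?_)
  rintro ⟨p, q⟩
  have e0 := Real.exp_lt_exp.2 h01
  have e1 := Real.exp_lt_exp.2 h12
  have p0 := Real.exp_pos (traceless s 0)
  have p1 := Real.exp_pos (traceless s 1)
  have p2 := Real.exp_pos (traceless s 2)
  suffices ∃ u v : ℝ,
      Real.exp (traceless s 0) * u + Real.exp (traceless s 1) * v +
        Real.exp (traceless s 2) * (-u - v) = p ∧
      (Real.exp (traceless s 0))⁻¹ * -u + (Real.exp (traceless s 1))⁻¹ * -v +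
        (Real.exp (traceless s 2))⁻¹ * -(-u - v) = q by
    obtain ⟨u, v, h1, h2⟩ := this
    refine ⟨(u, v), Prod.ext ?_ ?_⟩
    · rw [← h1]
      simp [Fin.sum_univ_three, L]
    · rw [← h2]
      simp [Fin.sum_univ_three, L, Real.exp_neg]
      ring
  generalize Real.exp (traceless s 0) = x at *
  generalize Real.exp (traceless s 1) = y at *
  generalize Real.exp (traceless s 2) = z at *
  have n1 : x - y ≠ 0 := by linarith
  have n2 : y - z ≠ 0 := by linarith
  have n3 : x - z ≠ 0 := by linarith
  refine ⟨x * (p - y * z * q) / ((x - y) * (x - z)), -y * (p - x * z * q) / ((x - y) * (y - z)),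
    ?_, ?_⟩
  · field_simp
    ring
  · field_simp
    ring

lemma isHorn_iff {l m a : Fin 3 → ℝ} : IsHorn l m a ↔
    (∀ i j k : Fin 3, (i : ℕ) + j = k → a k ≤ l i + m j) ∧
      ∀ i j k : Fin 3, (i : ℕ) + j = k + 2 → l i + m j ≤ a k :=
  ⟨fun h => ⟨h.1, h.2⟩, fun h => ⟨h.1, h.2⟩⟩

lemma attains_flat (x y : Fin 3 → ℝ) :
    Attains x y ((∑ i, x i) * (∑ j, y j) / 3) ((∑ i, x⁻¹ i) * (∑ j, y⁻¹ j) / 3) := by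
  have := (attains_of_blockRotation x y 0 0 zero_le_one le_rfl).convexCombination le_rfl zero_le_one
  simpa using this

lemma isCompact_deformation (l m : Fin 3 → ℝ) (c e : ℝ × ℝ) :
    IsCompact {p : ℝ × (ℝ × ℝ) | p.1 ∈ Set.Icc (0 : ℝ) 1 ∧ IsDominant (traceless p.2) ∧
      IsHorn l m (traceless p.2) ∧ e = (1 - p.1) • c + p.1 • expSymm p.2} := by
  have hK : IsCompact (Set.Icc (0 : ℝ) 1 ×ˢ (Set.Icc (l 2 + m 2) (l 0 + m 0) ×ˢ
      Set.Icc (l 2 + m 2) (l 0 + m 0))) := isCompact_Icc.prod (isCompact_Icc.prod isCompact_Icc)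
  refine hK.of_isClosed_subset ?_ ?_
  · have h : ∀ k, Continuous fun p : ℝ × (ℝ × ℝ) => traceless p.2 k := fun k =>
      (continuous_traceless k).comp continuous_snd
    have hE : Continuous fun p : ℝ × (ℝ × ℝ) => expSymm p.2 := continuous_expSymm.comp continuous_snd
    have hdom : ∀ s, IsDominant (traceless s) ↔
        traceless s 1 ≤ traceless s 0 ∧ traceless s 2 ≤ traceless s 1 := fun s =>
      ⟨fun h => ⟨h.1, h.2⟩, fun h => ⟨h.1, h.2, traceless_sum s⟩⟩
    simp only [isHorn_iff, hdom, Set.ofPred_and, Set.ofPred_forall]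
    refine (isClosed_Icc.preimage continuous_fst).inter (((isClosed_le (h 1) (h 0)).inter
      (isClosed_le (h 2) (h 1))).inter (IsClosed.inter (IsClosed.inter ?_ ?_) ?_))
    · exact isClosed_iInter fun i => isClosed_iInter fun j => isClosed_iInter fun k =>
        isClosed_iInter fun _ => isClosed_le (h k) continuous_const
    · exact isClosed_iInter fun i => isClosed_iInter fun j => isClosed_iInter fun k =>
        isClosed_iInter fun _ => isClosed_le continuous_const (h k)
    · exact isClosed_eq continuous_const (by fun_prop)
  · rintro ⟨t, s⟩ ⟨ht, hd, hh, -⟩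
    have u := hh.upper 0 0 0 rfl
    have v := hh.lower 2 2 2 rfl
    have h1 := hd.le01
    have h2 := hd.le12
    exact ⟨ht, ⟨v.trans (h2.trans h1), u⟩, ⟨v.trans h2, h1.trans u⟩⟩

/-- The Horn inequalities are sufficient when the first spectrum is simple. -/
lemma IsHorn.expAttains_of_regular {l m a : Fin 3 → ℝ} (h : IsHorn l m a) (hl : IsDominant l)
    (hm : IsDominant m) (ha : IsDominant a) (h01 : l 1 < l 0) (h12 : l 2 < l 1) :
    ExpAttains l m a := by
  let x : Fin 3 → ℝ := fun i => Real.exp (l i)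
  let y : Fin 3 → ℝ := fun i => Real.exp (m i)
  let c : ℝ × ℝ := ((∑ i, x i) * (∑ j, y j) / 3, (∑ i, x⁻¹ i) * (∑ j, y⁻¹ j) / 3)
  have hK := isCompact_deformation l m c (expSymm (a 0, a 1))
  obtain ⟨⟨t, s⟩, ⟨ht, hd, hh, he⟩, hmin⟩ := hK.exists_isMinOn
    ⟨(1, (a 0, a 1)), ⟨by simp, by rwa [traceless_eq ha.sum_eq], by rwa [traceless_eq ha.sum_eq],
      by simp⟩⟩ continuous_fst.continuousOn
  have hattain : ∀ p : ℝ × ℝ, Attains x y p.1 p.2 → expSymm (a 0, a 1) = (1 - t) • c + t • p →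
      ExpAttains l m a := by
    intro p hp hpe
    have := hp.convexCombination ht.1 ht.2
    have e : expSymm (a 0, a 1) = (∑ k, Real.exp (a k), ∑ k, Real.exp (-a k)) := by
      rw [expSymm, traceless_eq ha.sum_eq]
    rw [e, Prod.ext_iff] at hpe
    obtain ⟨h1, h2⟩ : ∑ k, Real.exp (a k) = _ ∧ ∑ k, Real.exp (-a k) = _ := hpe
    unfold ExpAttains
    rw [h1, h2]
    exact this
  by_contra hcon
  have hns : ¬ ExpAttains l m (traceless s) := fun hs => hcon (hattain (expSymm s) hs he)
  have ht0 : 0 < t := by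
    refine lt_of_le_of_ne ht.1 ?_
    rintro rfl
    exact hcon (hattain c (attains_flat x y) (by simpa using he))
  have hs01 : traceless s 1 < traceless s 0 := lt_of_le_of_ne hd.le01 fun h' =>
    hns (hh.expAttains_of_wall hl hm hd h01 h12 (Or.inl h'.symm))
  have hs12 : traceless s 2 < traceless s 1 := lt_of_le_of_ne hd.le12 fun h' =>
    hns (hh.expAttains_of_wall hl hm hd h01 h12 (Or.inr h'.symm))
  have hV : ∀ᶠ s' in 𝓝 s, IsDominant (traceless s') ∧ IsHorn l m (traceless s') := by
    have hc : ∀ k, Tendsto (fun s => traceless s k) (𝓝 s) (𝓝 (traceless s k)) := fun k =>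
      (continuous_traceless k).tendsto s
    have e1 : ∀ᶠ s' in 𝓝 s, ∀ i j k : Fin 3, (i : ℕ) + j = k → traceless s' k ≤ l i + m j := by
      simp only [eventually_all]
      exact fun i j k hijk => ((hc k).eventually_lt_const (lt_of_le_of_ne (hh.upper i j k hijk)
        fun h' => hns (hh.expAttains_of_eq hl hm hd (Or.inl hijk) h'))).mono fun _ => le_of_lt
    have e2 : ∀ᶠ s' in 𝓝 s, ∀ i j k : Fin 3, (i : ℕ) + j = k + 2 → l i + m j ≤ traceless s' k := by
      simp only [eventually_all]
      exact fun i j k hijk => ((hc k).eventually_const_lt (lt_of_le_of_ne (hh.lower i j k hijk)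
        fun h' => hns (hh.expAttains_of_eq hl hm hd (Or.inr hijk) h'.symm))).mono fun _ => le_of_lt
    filter_upwards [e1, e2, (hc 1).eventually_lt (hc 0) hs01, (hc 2).eventually_lt (hc 1) hs12]
      with s' h1 h2 h3 h4
    exact ⟨⟨h3.le, h4.le, traceless_sum s'⟩, ⟨h1, h2⟩⟩
  let g : ℝ → ℝ × ℝ := fun r => c + r⁻¹ • (expSymm (a 0, a 1) - c)
  have hgt : g t = expSymm s := by
    simp only [g, he]
    have : (1 - t) • c + t • expSymm s - c = t • (expSymm s - c) := by module
    rw [this, smul_smul, inv_mul_cancel₀ ht0.ne', one_smul]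
    abel
  have hg : Tendsto g (𝓝 t) (𝓝 (expSymm s)) := by
    rw [← hgt]
    exact ((tendsto_inv₀ ht0.ne').smul_const _).const_add c
  rw [← map_expSymm_nhds hs01 hs12] at hg
  have hev : ∀ᶠ t' in 𝓝 t, g t' ∈ expSymm ''
      {s' | IsDominant (traceless s') ∧ IsHorn l m (traceless s')} := hg (image_mem_map hV)
  obtain ⟨t', ⟨⟨s', ⟨hd', hh'⟩, hs'⟩, ht0'⟩, htt'⟩ :=
    (((hev.and (lt_mem_nhds ht0)).filter_mono
      (nhdsWithin_le_nhds (s := Set.Iio t))).and self_mem_nhdsWithin).exists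
  refine absurd (hmin (show ((t', s') : ℝ × (ℝ × ℝ)) ∈ _ from
    ⟨⟨le_of_lt ht0', (le_of_lt htt').trans ht.2⟩, hd', hh', ?_⟩)) (not_le.2 htt')
  have h1 : expSymm s' - c = t'⁻¹ • (expSymm (a 0, a 1) - c) := by
    rw [hs']
    simp [g]
  have h2 : t' • (expSymm s' - c) = expSymm (a 0, a 1) - c := by
    rw [h1, smul_smul, mul_inv_cancel₀ (ne_of_gt ht0'), one_smul]
  change expSymm (a 0, a 1) = (1 - t') • c + t' • expSymm s'
  rw [← sub_add_cancel (expSymm (a 0, a 1)) c, ← h2]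
  module

/-- The Horn inequalities for two factors are sufficient. -/
lemma IsHorn.expAttains {l m a : Fin 3 → ℝ} (h : IsHorn l m a) (hl : IsDominant l)
    (hm : IsDominant m) (ha : IsDominant a) : ExpAttains l m a := by
  let d : ℝ → (Fin 3 → ℝ) → Fin 3 → ℝ := fun ε v k => v k + ε * (1 - (k : ℕ))
  have hd : ∀ {ε v}, 0 ≤ ε → IsDominant v → IsDominant (d ε v) := fun hε hv =>
    ⟨by simp [d]; linarith [hv.le01], by simp [d]; linarith [hv.le12],
      by simp [d]; linarith [hv.sum_eq]⟩
  have hdc : ∀ v k, Continuous fun ε => d ε v k := fun v k => by fun_prop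
  have key : ∀ ε > 0, ExpAttains (d ε l) (d ε m) (d ε a) := by
    intro ε hε
    refine IsHorn.expAttains_of_regular ⟨?_, ?_⟩ (hd hε.le hl) (hd hε.le hm) (hd hε.le ha) ?_ ?_
    · intro i j k hijk
      have := h.upper i j k hijk
      have e : (i : ℝ) + j = k := by exact_mod_cast hijk
      simp only [d, ← e]
      linarith
    · intro i j k hijk
      have := h.lower i j k hijk
      have e : (k : ℝ) = i + j - 2 := by
        rw [eq_sub_iff_add_eq]
        exact_mod_cast hijk.symm
      simp only [d, e]
      linarith
    · simp [d]
      linarith [hl.le01]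
    · simp [d]
      linarith [hl.le12]
  choose P hP hP1 hP2 using fun n : ℕ => key (1 / (n + 1)) (by positivity)
  have : FirstCountableTopology (Matrix (Fin 3) (Fin 3) ℝ) :=
    inferInstanceAs (FirstCountableTopology (Fin 3 → Fin 3 → ℝ))
  obtain ⟨Q, hQ, φ, hφ, hlim⟩ := isCompact_unistochastic.tendsto_subseq hP
  have hε : Tendsto (fun n => 1 / ((φ n : ℝ) + 1)) atTop (𝓝 0) :=
    tendsto_one_div_add_atTop_nhds_zero_nat.comp hφ.tendsto_atTop
  have hd0 : ∀ v, d 0 v = v := fun v => by simp [d]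
  have hlimd : ∀ v k, Tendsto (fun n => d (1 / ((φ n : ℝ) + 1)) v k) atTop (𝓝 (v k)) := by
    intro v k
    have := ((hdc v k).tendsto 0).comp hε
    rwa [hd0] at this
  have hlimQ : ∀ i j, Tendsto (fun n => P (φ n) i j) atTop (𝓝 (Q i j)) := fun i j =>
    ((continuous_id.matrix_elem i j).tendsto Q).comp hlim
  refine ⟨Q, hQ, ?_, ?_⟩
  · refine tendsto_nhds_unique (f := fun n => pairing
      (fun i => Real.exp (d (1 / ((φ n : ℝ) + 1)) l i))
      (fun i => Real.exp (d (1 / ((φ n : ℝ) + 1)) m i)) (P (φ n))) (l := atTop) ?_ ?_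
    · exact tendsto_finsetSum _ fun i _ => tendsto_finsetSum _ fun j _ =>
        (((hlimd l i).rexp).mul ((hlimd m j).rexp)).mul (hlimQ i j)
    · simp only [hP1]
      exact tendsto_finsetSum _ fun k _ => (hlimd a k).rexp
  · refine tendsto_nhds_unique (f := fun n => pairing
      (fun i => Real.exp (d (1 / ((φ n : ℝ) + 1)) l i))⁻¹
      (fun i => Real.exp (d (1 / ((φ n : ℝ) + 1)) m i))⁻¹ (P (φ n))) (l := atTop) ?_ ?_
    · exact tendsto_finsetSum _ fun i _ => tendsto_finsetSum _ fun j _ =>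
        (((hlimd l i).rexp.inv₀ (Real.exp_ne_zero _)).mul
          ((hlimd m j).rexp.inv₀ (Real.exp_ne_zero _))).mul (hlimQ i j)
    · simp only [hP2]
      exact tendsto_finsetSum _ fun k _ => (hlimd a k).neg.rexp

end Deformation

section Merge

lemma exists_between_sum_eq_zero {l u : Fin 3 → ℝ} (hlu : ∀ k, l k ≤ u k)
    (hl1 : l 1 ≤ l 0) (hl2 : l 2 ≤ l 1) (hu1 : u 1 ≤ u 0) (hu2 : u 2 ≤ u 1)
    (hl : l 0 + l 1 + l 2 ≤ 0) (hu : 0 ≤ u 0 + u 1 + u 2) :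
    ∃ a, IsDominant a ∧ ∀ k, l k ≤ a k ∧ a k ≤ u k := by
  obtain ⟨t, ht0, ht1, ht⟩ : ∃ t : ℝ, 0 ≤ t ∧ t ≤ 1 ∧
      (1 - t) * (l 0 + l 1 + l 2) + t * (u 0 + u 1 + u 2) = 0 := by
    obtain h | h := hu.eq_or_lt
    · exact ⟨1, by simp, by simp, by simp [← h]⟩
    · have hd : 0 < (u 0 + u 1 + u 2) - (l 0 + l 1 + l 2) := by linarith
      refine ⟨-(l 0 + l 1 + l 2) / ((u 0 + u 1 + u 2) - (l 0 + l 1 + l 2)),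
        div_nonneg (by linarith) hd.le, (div_le_one hd).2 (by linarith), ?_⟩
      field_simp
      ring
  refine ⟨fun k => (1 - t) * l k + t * u k, ⟨?_, ?_, ?_⟩, fun k => ⟨?_, ?_⟩⟩
  · nlinarith
  · nlinarith
  · linarith
  · nlinarith [hlu k]
  · nlinarith [hlu k]

lemma exists_dominant_of_bounds {l m : Fin 3 → ℝ} (hl : IsDominant l) (hm : IsDominant m)
    {A C M X X' Y Y' : ℝ} (hX : 0 ≤ X) (hXX : X ≤ X') (hX' : X' ≤ 2 * A + C)
    (hY : 0 ≤ Y) (hYY : Y ≤ Y') (hY' : Y' ≤ -A - 2 * C)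
    (hXM : X ≤ M) (hYM : Y ≤ M) (hM1 : M ≤ X - A - 2 * C) (hM2 : M ≤ Y + 2 * A + C)
    (t0 : l 0 + m 2 + C ≤ 0) (t1 : l 2 + m 0 + C ≤ 0) (t2 : l 2 + m 2 + C + M ≤ 0)
    (t3 : l 1 + m 1 + C ≤ 0) (t4 : l 1 + m 2 + C + Y ≤ 0) (t5 : l 2 + m 1 + C + Y ≤ 0)
    (t6 : l 2 + m 2 + C + Y' ≤ 0)
    (s0 : 0 ≤ l 2 + m 0 + A) (s1 : 0 ≤ l 0 + m 2 + A) (s2 : 0 ≤ l 0 + m 0 + A - M)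
    (s3 : 0 ≤ l 1 + m 1 + A) (s4 : 0 ≤ l 1 + m 0 + A - X) (s5 : 0 ≤ l 0 + m 1 + A - X)
    (s6 : 0 ≤ l 0 + m 0 + A - X') :
    ∃ a, IsDominant a ∧ IsHorn l m a ∧ a 0 + C ≤ 0 ∧ a 1 + C + Y ≤ 0 ∧ a 2 + C + M ≤ 0 ∧
      a 2 + C + Y' ≤ 0 ∧ 0 ≤ a 2 + A ∧ 0 ≤ a 1 + A - X ∧ 0 ≤ a 0 + A - M ∧ 0 ≤ a 0 + A - X' := by
  obtain ⟨hl1, hl2, hl3⟩ := hl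
  obtain ⟨hm1, hm2, hm3⟩ := hm
  have hmin : ∀ S : Finset ℝ, S.Nonempty → ∃ u ∈ S, ∀ x ∈ S, u ≤ x := fun S hS =>
    S.exists_min_image id hS
  have hmax : ∀ S : Finset ℝ, S.Nonempty → ∃ u ∈ S, ∀ x ∈ S, x ≤ u := fun S hS =>
    S.exists_max_image id hS
  obtain ⟨u0, hu0, hu0'⟩ := hmin {l 0 + m 0, -C} (by simp)
  obtain ⟨u1, hu1, hu1'⟩ := hmin {l 0 + m 1, l 1 + m 0, -C - Y} (by simp)
  obtain ⟨u2, hu2, hu2'⟩ := hmin {l 0 + m 2, l 1 + m 1, l 2 + m 0, -C - M, -C - Y'} (by simp)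
  obtain ⟨v0, hv0, hv0'⟩ := hmax {l 0 + m 2, l 1 + m 1, l 2 + m 0, M - A, X' - A} (by simp)
  obtain ⟨v1, hv1, hv1'⟩ := hmax {l 1 + m 2, l 2 + m 1, X - A} (by simp)
  obtain ⟨v2, hv2, hv2'⟩ := hmax {l 2 + m 2, -A} (by simp)
  simp only [Finset.mem_insert, Finset.mem_singleton, forall_eq_or_imp, forall_eq] at *
  obtain ⟨p00, p01⟩ := hu0'
  obtain ⟨p10, p11, p12⟩ := hu1'
  obtain ⟨p20, p21, p22, p23, p24⟩ := hu2'
  obtain ⟨q00, q01, q02, q03, q04⟩ := hv0'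
  obtain ⟨q10, q11, q12⟩ := hv1'
  obtain ⟨q20, q21⟩ := hv2'
  obtain ⟨a, ha, hva⟩ := exists_between_sum_eq_zero (l := ![v0, v1, v2]) (u := ![u0, u1, u2])
    (by
      intro k
      fin_cases k
      · change v0 ≤ u0
        rcases hv0 with rfl | rfl | rfl | rfl | rfl <;> rcases hu0 with rfl | rfl <;> linarith
      · change v1 ≤ u1
        rcases hv1 with rfl | rfl | rfl <;> rcases hu1 with rfl | rfl | rfl <;> linarith
      · change v2 ≤ u2
        rcases hv2 with rfl | rfl <;> rcases hu2 with rfl | rfl | rfl | rfl | rfl <;> linarith)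
    (by change v1 ≤ v0; rcases hv1 with rfl | rfl | rfl <;> linarith)
    (by change v2 ≤ v1; rcases hv2 with rfl | rfl <;> linarith)
    (by change u1 ≤ u0; rcases hu0 with rfl | rfl <;> linarith)
    (by change u2 ≤ u1; rcases hu1 with rfl | rfl | rfl <;> linarith)
    (by
      change v0 + v1 + v2 ≤ 0
      clear * - hv0 hv1 hv2 hl1 hl2 hl3 hm1 hm2 hm3 hX hXX hX' hY hYY hY' hXM hYM hM1 hM2 t0 t1 t2
        t3 t4 t5 t6 s0 s1 s2 s3 s4 s5 s6
      rcases hv0 with rfl | rfl | rfl | rfl | rfl <;> rcases hv1 with rfl | rfl | rfl <;>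
        rcases hv2 with rfl | rfl <;> linarith)
    (by
      change 0 ≤ u0 + u1 + u2
      clear * - hu0 hu1 hu2 hl1 hl2 hl3 hm1 hm2 hm3 hX hXX hX' hY hYY hY' hXM hYM hM1 hM2 t0 t1 t2
        t3 t4 t5 t6 s0 s1 s2 s3 s4 s5 s6
      rcases hu2 with rfl | rfl | rfl | rfl | rfl <;> rcases hu1 with rfl | rfl | rfl <;>
        rcases hu0 with rfl | rfl <;> linarith)
  obtain ⟨g0, f0⟩ : v0 ≤ a 0 ∧ a 0 ≤ u0 := hva 0
  obtain ⟨g1, f1⟩ : v1 ≤ a 1 ∧ a 1 ≤ u1 := hva 1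
  obtain ⟨g2, f2⟩ : v2 ≤ a 2 ∧ a 2 ≤ u2 := hva 2
  refine ⟨a, ha, ⟨?_, ?_⟩, by linarith, by linarith, by linarith, by linarith, by linarith,
    by linarith, by linarith, by linarith⟩
  · have hcases : ∀ i j k : Fin 3, (i : ℕ) + j = k → (i = 0 ∧ j = 0 ∧ k = 0) ∨
        (i = 0 ∧ j = 1 ∧ k = 1) ∨ (i = 1 ∧ j = 0 ∧ k = 1) ∨ (i = 0 ∧ j = 2 ∧ k = 2) ∨
        (i = 1 ∧ j = 1 ∧ k = 2) ∨ (i = 2 ∧ j = 0 ∧ k = 2) := by decide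
    intro i j k h
    rcases hcases i j k h with ⟨rfl, rfl, rfl⟩ | ⟨rfl, rfl, rfl⟩ | ⟨rfl, rfl, rfl⟩ |
      ⟨rfl, rfl, rfl⟩ | ⟨rfl, rfl, rfl⟩ | ⟨rfl, rfl, rfl⟩ <;> linarith
  · have hcases : ∀ i j k : Fin 3, (i : ℕ) + j = k + 2 → (i = 0 ∧ j = 2 ∧ k = 0) ∨
        (i = 1 ∧ j = 1 ∧ k = 0) ∨ (i = 2 ∧ j = 0 ∧ k = 0) ∨ (i = 1 ∧ j = 2 ∧ k = 1) ∨
        (i = 2 ∧ j = 1 ∧ k = 1) ∨ (i = 2 ∧ j = 2 ∧ k = 2) := by decide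
    intro i j k h
    rcases hcases i j k h with ⟨rfl, rfl, rfl⟩ | ⟨rfl, rfl, rfl⟩ | ⟨rfl, rfl, rfl⟩ |
      ⟨rfl, rfl, rfl⟩ | ⟨rfl, rfl, rfl⟩ | ⟨rfl, rfl, rfl⟩ <;> linarith

lemma exists_least_upper_bound_of_nonneg {ι : Type*} [Finite ι] (f : ι → ℝ) :
    ∃ M, 0 ≤ M ∧ (∀ i, f i ≤ M) ∧ ∀ c, 0 ≤ c → (∀ i, f i ≤ c) → M ≤ c := by
  obtain ⟨o, ho⟩ := Finite.exists_max fun o : Option ι => o.elim 0 f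
  refine ⟨_, ho none, fun i => ho (some i), fun c hc hf => ?_⟩
  cases o with
  | none => exact hc
  | some i => exact hf i

lemma add_le_sum_of_ne {n : ℕ} {f : Fin n → ℝ} (hf : ∀ i, 0 ≤ f i) {i j : Fin n} (hij : i ≠ j) :
    f i + f j ≤ ∑ k, f k := by
  rw [← Finset.sum_pair hij]
  exact Finset.sum_le_univ_sum_of_nonneg hf

/-- The stability inequalities for a family of vectors with three entries. -/
def IsStable {n : ℕ} (v : Fin n → Fin 3 → ℝ) : Prop :=
  StabilityIneqs (fun i => v i 0) (fun i => v i 1) (fun i => v i 2)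

/-- Two members of a stable family can be merged into one. -/
lemma IsStable.exists_merge {n : ℕ} {v : Fin (n + 2) → Fin 3 → ℝ} (hv : ∀ i, IsDominant (v i))
    (h : IsStable v) : ∃ a, IsDominant a ∧ IsHorn (v 0) (v 1) a ∧
      IsStable (Fin.cons a fun i => v i.succ.succ : Fin (n + 1) → Fin 3 → ℝ) := by
  obtain ⟨w, hw⟩ : ∃ w : Fin n → Fin 3 → ℝ, ∀ i, v i.succ.succ = w i :=
    ⟨fun i => v i.succ.succ, fun _ => rfl⟩
  have hwd : ∀ i, IsDominant (w i) := fun i => hw i ▸ hv _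
  have hx : ∀ i, 0 ≤ w i 0 - w i 1 := fun i => sub_nonneg.2 (hwd i).le01
  have hy : ∀ i, 0 ≤ w i 1 - w i 2 := fun i => sub_nonneg.2 (hwd i).le12
  have hsum : ∀ k, ∑ i, v i k = v 0 k + (v 1 k + ∑ i, w i k) := fun k => by
    simp only [Fin.sum_univ_succ, hw]
    rfl
  have hX0 : ∑ i, (w i 0 - w i 1) = 2 * ∑ i, w i 0 + ∑ i, w i 2 := by
    rw [Finset.mul_sum, ← Finset.sum_add_distrib]
    exact Finset.sum_congr rfl fun i _ => by linarith [(hwd i).sum_eq]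
  have hY0 : ∑ i, (w i 1 - w i 2) = -∑ i, w i 0 - 2 * ∑ i, w i 2 := by
    rw [Finset.mul_sum, ← Finset.sum_neg_distrib, ← Finset.sum_sub_distrib]
    exact Finset.sum_congr rfl fun i _ => by linarith [(hwd i).sum_eq]
  have hpair : ∀ f : Fin n → ℝ, (∀ i, 0 ≤ f i) → ∀ p : Fin n × Fin n,
      (if p.1 = p.2 then f p.1 else f p.1 + f p.2) ≤ ∑ i, f i := by
    intro f hf p
    split_ifs with h
    · exact Finset.single_le_sum (fun i _ => hf i) (Finset.mem_univ _)
    · exact add_le_sum_of_ne hf h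
  have hXs := Finset.sum_nonneg fun i (_ : i ∈ univ) => hx i
  have hYs := Finset.sum_nonneg fun i (_ : i ∈ univ) => hy i
  obtain ⟨X, hXn, hX, hX'⟩ := exists_least_upper_bound_of_nonneg fun i => w i 0 - w i 1
  obtain ⟨Y, hYn, hY, hY'⟩ := exists_least_upper_bound_of_nonneg fun i => w i 1 - w i 2
  obtain ⟨M, hMn, hM, hM'⟩ := exists_least_upper_bound_of_nonneg fun i => w i 0 - w i 2
  obtain ⟨XX, hXXn, hXX, hXX'⟩ := exists_least_upper_bound_of_nonneg fun p : Fin n × Fin n =>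
    if p.1 = p.2 then w p.1 0 - w p.1 1 else (w p.1 0 - w p.1 1) + (w p.2 0 - w p.2 1)
  obtain ⟨YY, hYYn, hYY, hYY'⟩ := exists_least_upper_bound_of_nonneg fun p : Fin n × Fin n =>
    if p.1 = p.2 then w p.1 1 - w p.1 2 else (w p.1 1 - w p.1 2) + (w p.2 1 - w p.2 2)
  have htop : ∀ i, v i 0 - v i 2 + ∑ j, v j 2 ≤ 0 := h.top
  have hmid : ∀ i j, i ≠ j → (v i 1 - v i 2) + (v j 1 - v j 2) + ∑ k, v k 2 ≤ 0 := h.mid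
  have hbot : ∀ i, 0 ≤ v i 2 - v i 0 + ∑ j, v j 0 := h.bot
  have hmid' : ∀ i j, i ≠ j → 0 ≤ (v i 1 - v i 0) + (v j 1 - v j 0) + ∑ k, v k 0 := h.mid'
  simp only [hsum] at htop hmid hbot hmid'
  have n0 : ∀ i : Fin n, (0 : Fin (n + 2)) ≠ i.succ.succ := fun i => (Fin.succ_ne_zero _).symm
  have n1 : ∀ i : Fin n, (1 : Fin (n + 2)) ≠ i.succ.succ := fun i h =>
    Fin.succ_ne_zero i (Fin.succ_injective (n + 1) (a₁ := 0) h).symm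
  have nn : ∀ i j : Fin n, i ≠ j → i.succ.succ ≠ j.succ.succ := fun i j hij h =>
    hij (Fin.succ_injective _ (Fin.succ_injective _ h))
  have top0 := htop 0
  have top1 := htop 1
  have bot0 := hbot 0
  have bot1 := hbot 1
  have mid01 := hmid 0 1 (by simp)
  have mid01' := hmid' 0 1 (by simp)
  have topw := fun i : Fin n => htop i.succ.succ
  have botw := fun i : Fin n => hbot i.succ.succ
  have mid0 := fun i : Fin n => hmid 0 i.succ.succ (n0 i)
  have mid1 := fun i : Fin n => hmid 1 i.succ.succ (n1 i)
  have mid0' := fun i : Fin n => hmid' 0 i.succ.succ (n0 i)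
  have mid1' := fun i : Fin n => hmid' 1 i.succ.succ (n1 i)
  have midw := fun (i j : Fin n) hij => hmid i.succ.succ j.succ.succ (nn i j hij)
  have midw' := fun (i j : Fin n) hij => hmid' i.succ.succ j.succ.succ (nn i j hij)
  simp only [hw] at topw botw mid0 mid1 mid0' mid1' midw midw'
  have d0 := (hv 0).le01
  have d0' := (hv 0).le12
  have d1 := (hv 1).le01
  have d1' := (hv 1).le12
  obtain ⟨a, ha, hhorn, c0, c1, c2, c3, e0, e1, e2, e3⟩ := exists_dominant_of_bounds (hv 0) (hv 1)
    (A := ∑ i, w i 0) (C := ∑ i, w i 2) (M := M) (X := X) (X' := XX) (Y := Y) (Y' := YY)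
    hXn (hX' _ hXXn fun i => by simpa using hXX (i, i))
    (hX0 ▸ hXX' _ hXs (hpair _ hx))
    hYn (hY' _ hYYn fun i => by simpa using hYY (i, i))
    (hY0 ▸ hYY' _ hYs (hpair _ hy))
    (hX' _ hMn fun i => by linarith [hM i, hy i])
    (hY' _ hMn fun i => by linarith [hM i, hx i])
    (hM' _ (by linarith) fun i => by
      have := hpair _ hy (i, i)
      rw [if_pos rfl] at this
      linarith [hX i])
    (hM' _ (by linarith) fun i => by
      have := hpair _ hx (i, i)
      rw [if_pos rfl] at this
      linarith [hY i])
    (by linarith) (by linarith)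
    (by
      have : M ≤ -(v 0 2 + v 1 2 + ∑ i, w i 2) :=
        hM' _ (by linarith) fun i => by linarith [topw i]
      linarith)
    (by linarith)
    (by
      have : Y ≤ -(v 0 1 + v 1 2 + ∑ i, w i 2) :=
        hY' _ (by linarith) fun i => by linarith [mid0 i]
      linarith)
    (by
      have : Y ≤ -(v 0 2 + v 1 1 + ∑ i, w i 2) :=
        hY' _ (by linarith) fun i => by linarith [mid1 i]
      linarith)
    (by
      have : YY ≤ -(v 0 2 + v 1 2 + ∑ i, w i 2) := by
        refine hYY' _ (by linarith) fun p => ?_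
        split_ifs with hp
        · linarith [topw p.1, hx p.1]
        · linarith [midw _ _ hp]
      linarith)
    (by linarith) (by linarith)
    (by
      have : M ≤ v 0 0 + v 1 0 + ∑ i, w i 0 :=
        hM' _ (by linarith) fun i => by linarith [botw i]
      linarith)
    (by linarith)
    (by
      have : X ≤ v 0 1 + v 1 0 + ∑ i, w i 0 :=
        hX' _ (by linarith) fun i => by linarith [mid0' i]
      linarith)
    (by
      have : X ≤ v 0 0 + v 1 1 + ∑ i, w i 0 :=
        hX' _ (by linarith) fun i => by linarith [mid1' i]
      linarith)
    (by
      have : XX ≤ v 0 0 + v 1 0 + ∑ i, w i 0 := by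
        refine hXX' _ (by linarith) fun p => ?_
        split_ifs with hp
        · linarith [botw p.1, hy p.1]
        · linarith [midw' _ _ hp]
      linarith)
  refine ⟨a, ha, hhorn, ?_⟩
  simp only [hw]
  refine ⟨?_, ?_, ?_, ?_⟩ <;> simp only [Fin.sum_univ_succ, Fin.cons_zero, Fin.cons_succ] <;> intro i
  · cases i using Fin.cases with
    | zero => simp only [Fin.cons_zero]; linarith
    | succ i => simp only [Fin.cons_succ]; linarith [hM i]
  · intro j hij
    cases i using Fin.cases with
    | zero => cases j using Fin.cases with
      | zero => exact absurd rfl hij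
      | succ j => simp only [Fin.cons_zero, Fin.cons_succ]; linarith [hY j]
    | succ i => cases j using Fin.cases with
      | zero => simp only [Fin.cons_zero, Fin.cons_succ]; linarith [hY i]
      | succ j =>
        have := hYY (i, j)
        rw [if_neg fun h : i = j => hij (congrArg _ h)] at this
        simp only [Fin.cons_succ]
        linarith
  · cases i using Fin.cases with
    | zero => simp only [Fin.cons_zero]; linarith
    | succ i => simp only [Fin.cons_succ]; linarith [hM i]
  · intro j hij
    cases i using Fin.cases with
    | zero => cases j using Fin.cases with
      | zero => exact absurd rfl hij
      | succ j => simp only [Fin.cons_zero, Fin.cons_succ]; linarith [hX j]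
    | succ i => cases j using Fin.cases with
      | zero => simp only [Fin.cons_zero, Fin.cons_succ]; linarith [hX i]
      | succ j =>
        have := hXX (i, j)
        rw [if_neg fun h : i = j => hij (congrArg _ h)] at this
        simp only [Fin.cons_succ]
        linarith

end Merge

section Realization

lemma HasSquaredSingularValues.mul_unitary {A V : Matrix (Fin 3) (Fin 3) ℂ} {z : Fin 3 → ℝ}
    (h : HasSquaredSingularValues A z) (hV : V * Vᴴ = 1) (hdet : V.det = 1) :
    HasSquaredSingularValues (A * V) z := by
  refine ⟨by rw [det_mul, h.1, hdet, one_mul], ?_⟩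
  rw [conjTranspose_mul, Matrix.mul_assoc A, ← Matrix.mul_assoc V, hV, Matrix.one_mul, h.2]

lemma HasSquaredSingularValues.unitary_mul {A U : Matrix (Fin 3) (Fin 3) ℂ} {z : Fin 3 → ℝ}
    (h : HasSquaredSingularValues A z) (hU : U * Uᴴ = 1) (hdet : U.det = 1) :
    HasSquaredSingularValues (U * A) z := by
  refine ⟨by rw [det_mul, h.1, hdet, one_mul], ?_⟩
  have hU' : Uᴴ * U = 1 := mul_eq_one_comm.1 hU
  rw [conjTranspose_mul, Matrix.mul_assoc U, charpoly_mul_comm, ← Matrix.mul_assoc A,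
    Matrix.mul_assoc, hU', Matrix.mul_one, h.2]

/-- Matrices with the same singular values differ by special unitary factors. -/
lemma HasSquaredSingularValues.exists_special_unitary {A B : Matrix (Fin 3) (Fin 3) ℂ} {z : Fin 3 → ℝ}
    (hA : HasSquaredSingularValues A z) (hB : HasSquaredSingularValues B z) :
    ∃ U V : Matrix (Fin 3) (Fin 3) ℂ, U * Uᴴ = 1 ∧ U.det = 1 ∧ V * Vᴴ = 1 ∧ V.det = 1 ∧
      B = U * A * V := by
  obtain ⟨W, hW, hAW⟩ := exists_unitary_diagonalization (𝕜 := ℂ)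
    (isHermitian_mul_conjTranspose_self A) hA.2
  obtain ⟨W', hW', hBW⟩ := exists_unitary_diagonalization (𝕜 := ℂ)
    (isHermitian_mul_conjTranspose_self B) hB.2
  rw [mem_unitaryGroup_iff, star_eq_conjTranspose] at hW hW'
  rw [star_eq_conjTranspose] at hAW hBW
  have hW2 : Wᴴ * W = 1 := mul_eq_one_comm.1 hW
  let U' := W' * Wᴴ
  have hU' : U' * U'ᴴ = 1 := by
    simp only [U', conjTranspose_mul, conjTranspose_conjTranspose]
    rw [Matrix.mul_assoc, ← Matrix.mul_assoc Wᴴ, hW2, Matrix.one_mul, hW']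
  have hUA : U' * (A * Aᴴ) * U'ᴴ = B * Bᴴ := by
    rw [hAW, hBW]
    simp only [U', conjTranspose_mul, conjTranspose_conjTranspose]
    calc _ = W' * (Wᴴ * W) * diagonal (fun j => ((z j : ℝ) : ℂ)) * (Wᴴ * W) * W'ᴴ := by
          simp only [Matrix.mul_assoc]
          rfl
      _ = _ := by
          rw [hW2, Matrix.mul_one, Matrix.mul_one]
          rfl
  have hdet : U'.det * star U'.det = 1 := by
    rw [← det_conjTranspose, ← det_mul, hU', det_one]
  obtain ⟨ζ, hζ⟩ := IsAlgClosed.exists_pow_nat_eq (star U'.det) (n := 3) (by norm_num)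
  have hζ1 : ζ * star ζ = 1 := by
    have h1 : ‖U'.det‖ = 1 := by
      have := congrArg norm hdet
      rw [norm_mul, norm_star, norm_one, ← sq] at this
      exact (pow_eq_one_iff_of_nonneg (norm_nonneg _) two_ne_zero).1 this
    have h2 : ‖ζ‖ = 1 := by
      have := congrArg norm hζ
      rw [norm_pow, norm_star, h1] at this
      exact (pow_eq_one_iff_of_nonneg (norm_nonneg _) three_ne_zero).1 this
    rw [← starRingEnd_apply, Complex.mul_conj', h2]
    simp
  have hζ2 : star ζ * ζ = 1 := by rw [mul_comm, hζ1]
  let U := ζ • U'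
  have hU : U * Uᴴ = 1 := by
    simp only [U, conjTranspose_smul, Matrix.smul_mul, Matrix.mul_smul, smul_smul, hU',
      hζ2, one_smul]
  have hUdet : U.det = 1 := by
    simp only [U, det_smul, Fintype.card_fin, hζ]
    rw [mul_comm, hdet]
  have hUA' : (U * A) * (U * A)ᴴ = B * Bᴴ := by
    rw [← hUA]
    simp only [U, conjTranspose_mul, conjTranspose_smul, Matrix.smul_mul, Matrix.mul_smul, smul_smul,
      hζ2, one_smul, Matrix.mul_assoc]
  have hUAdet : (U * A).det = 1 := by rw [det_mul, hUdet, hA.1, one_mul]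
  have hunit : IsUnit (U * A).det := by
    rw [hUAdet]
    exact isUnit_one
  refine ⟨U, (U * A)⁻¹ * B, hU, hUdet, ?_, ?_, ?_⟩
  · rw [conjTranspose_mul, Matrix.mul_assoc, ← Matrix.mul_assoc B, ← hUA', Matrix.mul_assoc,
      ← Matrix.mul_assoc, nonsing_inv_mul _ hunit, Matrix.one_mul, ← conjTranspose_mul,
      nonsing_inv_mul _ hunit, conjTranspose_one]
  · rw [det_mul, det_nonsing_inv, hUAdet, hB.1]
    simp
  · rw [← Matrix.mul_assoc, mul_nonsing_inv _ hunit, Matrix.one_mul]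

lemma trace_mul_conjTranspose_self (M : Matrix (Fin 3) (Fin 3) ℂ) :
    (M * Mᴴ).trace = ((∑ i, ∑ j, ‖M i j‖ ^ 2 : ℝ) : ℂ) := by
  simp [trace, mul_apply, Complex.mul_conj']

/-- A criterion for singular values in terms of norms of the entries. -/
lemma hasSquaredSingularValues_of_norm {M N : Matrix (Fin 3) (Fin 3) ℂ} {v : Fin 3 → ℝ}
    (hv : v 0 + v 1 + v 2 = 0) (hM : M.det = 1) (hMN : M * N = 1)
    (h1 : ∑ i, ∑ j, ‖M i j‖ ^ 2 = ∑ k, Real.exp (2 * v k))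
    (h2 : ∑ i, ∑ j, ‖N i j‖ ^ 2 = ∑ k, Real.exp (-(2 * v k))) :
    HasSquaredSingularValues M fun k => Real.exp (2 * v k) := by
  have hN : M.adjugate = N := by
    have h3 : M.adjugate * M = 1 := by rw [adjugate_mul, hM, one_smul]
    rw [← Matrix.mul_one M.adjugate, ← hMN, ← Matrix.mul_assoc, h3, Matrix.one_mul]
  refine ⟨hM, charpoly_eq_prod_of_symm _ _ ?_ ?_ ?_⟩
  · rw [trace_mul_conjTranspose_self, h1, Fin.sum_univ_three]
    push_cast
    rfl
  · rw [adjugate_mul_distrib, ← adjugate_conjTranspose, hN, trace_mul_comm,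
      trace_mul_conjTranspose_self, h2, Fin.sum_univ_three]
    rw [show -(2 * v 0) = 2 * v 1 + 2 * v 2 by linarith,
      show -(2 * v 1) = 2 * v 0 + 2 * v 2 by linarith,
      show -(2 * v 2) = 2 * v 0 + 2 * v 1 by linarith]
    simp only [Real.exp_add]
    push_cast
    ring
  · rw [det_mul, det_conjTranspose, hM, star_one, mul_one, ← Complex.ofReal_mul,
      ← Complex.ofReal_mul, ← Real.exp_add, ← Real.exp_add, ← mul_add, ← mul_add, hv]
    simp

/-- Diagonal matrices of exponentials. -/
noncomputable def expDiagonal (v : Fin 3 → ℝ) : Matrix (Fin 3) (Fin 3) ℂ :=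
  diagonal fun k => (Real.exp (v k) : ℂ)

lemma expDiagonal_mul_expDiagonal_neg (v : Fin 3 → ℝ) :
    expDiagonal v * expDiagonal (fun k => -v k) = 1 := by
  rw [expDiagonal, expDiagonal, diagonal_mul_diagonal, ← diagonal_one]
  congr 1
  ext k
  rw [← Complex.ofReal_mul, ← Real.exp_add]
  simp

lemma det_expDiagonal {v : Fin 3 → ℝ} (hv : v 0 + v 1 + v 2 = 0) : (expDiagonal v).det = 1 := by
  rw [expDiagonal, det_diagonal, Fin.prod_univ_three, ← Complex.ofReal_mul, ← Complex.ofReal_mul,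
    ← Real.exp_add, ← Real.exp_add, hv]
  simp

lemma norm_expDiagonal_mul_mul (u v : Fin 3 → ℝ) (U : Matrix (Fin 3) (Fin 3) ℂ) (i j : Fin 3) :
    ‖(expDiagonal u * U * expDiagonal v) i j‖ ^ 2 =
      Real.exp (2 * u i) * Real.exp (2 * v j) * ‖U i j‖ ^ 2 := by
  rw [expDiagonal, expDiagonal, mul_diagonal, diagonal_mul, norm_mul, norm_mul, Complex.norm_real,
    Complex.norm_real, Real.norm_eq_abs, Real.norm_eq_abs, Real.abs_exp, Real.abs_exp, two_mul,
    two_mul, Real.exp_add, Real.exp_add]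
  ring

lemma hasSquaredSingularValues_expDiagonal {v : Fin 3 → ℝ} (hv : v 0 + v 1 + v 2 = 0) :
    HasSquaredSingularValues (expDiagonal v) fun k => Real.exp (2 * v k) := by
  have h : ∀ v : Fin 3 → ℝ, ∑ i, ∑ j, ‖expDiagonal v i j‖ ^ 2 = ∑ k, Real.exp (2 * v k) := by
    intro v
    refine Finset.sum_congr rfl fun i _ => ?_
    rw [Finset.sum_eq_single i (fun j _ hj => by simp [expDiagonal, hj.symm]) (by simp)]
    simp [expDiagonal, two_mul, Real.exp_add, sq]
  refine hasSquaredSingularValues_of_norm hv (det_expDiagonal hv)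
    (expDiagonal_mul_expDiagonal_neg v) (h v) ?_
  rw [h]
  simp only [mul_neg]

/-- The Horn inequalities are realized by products of two matrices. -/
lemma IsHorn.exists_mul {l m a : Fin 3 → ℝ} (h : IsHorn l m a) (hl : IsDominant l)
    (hm : IsDominant m) (ha : IsDominant a) : ∃ A B : Matrix (Fin 3) (Fin 3) ℂ,
      HasSquaredSingularValues A (fun k => Real.exp (2 * l k)) ∧
      HasSquaredSingularValues B (fun k => Real.exp (2 * m k)) ∧
      HasSquaredSingularValues (A * B) (fun k => Real.exp (2 * a k)) := by
  have hdom : ∀ {v : Fin 3 → ℝ}, IsDominant v → IsDominant fun k => 2 * v k := fun hv =>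
    ⟨by linarith [hv.le01], by linarith [hv.le12], by linarith [hv.sum_eq]⟩
  have h' : IsHorn (fun k => 2 * l k) (fun k => 2 * m k) (fun k => 2 * a k) :=
    ⟨fun i j k hijk => by linarith [h.upper i j k hijk],
      fun i j k hijk => by linarith [h.lower i j k hijk]⟩
  obtain ⟨P, hP, h1, h2⟩ := h'.expAttains (hdom hl) (hdom hm) (hdom ha)
  obtain ⟨U, hU, hUdet, hUP⟩ := exists_unitary_of_mem_unistochastic hP
  refine ⟨expDiagonal l * U, expDiagonal m,
    (hasSquaredSingularValues_expDiagonal hl.sum_eq).mul_unitary hU hUdet,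
    hasSquaredSingularValues_expDiagonal hm.sum_eq,
    hasSquaredSingularValues_of_norm (N := expDiagonal (fun k => -m k) * Uᴴ *
      expDiagonal fun k => -l k) ha.sum_eq ?_ ?_ ?_ ?_⟩
  · rw [det_mul, det_mul, det_expDiagonal hl.sum_eq, det_expDiagonal hm.sum_eq, hUdet, one_mul,
      one_mul]
  · calc _ = expDiagonal l * (U * (expDiagonal m * expDiagonal (fun k => -m k)) * Uᴴ) *
        expDiagonal (fun k => -l k) := by simp only [Matrix.mul_assoc]
      _ = 1 := by
        rw [expDiagonal_mul_expDiagonal_neg, Matrix.mul_one, hU, Matrix.mul_one,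
          expDiagonal_mul_expDiagonal_neg]
  · rw [← h1]
    simp only [norm_expDiagonal_mul_mul, hUP, pairing]
  · rw [← h2, Finset.sum_comm]
    simp only [norm_expDiagonal_mul_mul, conjTranspose_apply, norm_star, hUP, pairing,
      Pi.inv_apply, ← Real.exp_neg, mul_neg]
    refine Finset.sum_congr rfl fun i _ => Finset.sum_congr rfl fun j _ => by ring

/-- Stable families are realized by matrices with product one. -/
lemma IsStable.exists_prod_eq_one : ∀ {n : ℕ} {v : Fin (n + 1) → Fin 3 → ℝ},
    (∀ i, IsDominant (v i)) → IsStable v → ∃ A : Fin (n + 1) → Matrix (Fin 3) (Fin 3) ℂ,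
      (List.ofFn A).prod = 1 ∧
        ∀ i, HasSquaredSingularValues (A i) fun k => Real.exp (2 * v i k)
  | 0, v, hv, h => by
    have h0 : v 0 = 0 := by
      have h1 : v 0 0 - v 0 2 + ∑ j : Fin 1, v j 2 ≤ 0 := h.top 0
      have h2 : 0 ≤ v 0 2 - v 0 0 + ∑ j : Fin 1, v j 0 := h.bot 0
      simp at h1 h2
      have h3 := (hv 0).le01
      have h4 := (hv 0).le12
      ext k
      fin_cases k
      · change v 0 0 = 0
        linarith
      · change v 0 1 = 0
        linarith
      · change v 0 2 = 0
        linarith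
    refine ⟨fun _ => 1, by simp, fun i => ?_⟩
    obtain rfl : i = 0 := Fin.eq_zero i
    have := hasSquaredSingularValues_expDiagonal (hv 0).sum_eq
    rw [h0] at this ⊢
    simpa [expDiagonal] using this
  | n + 1, v, hv, h => by
    obtain ⟨a, ha, hhorn, hstab⟩ := h.exists_merge hv
    obtain ⟨A, hA, hAz⟩ := hstab.exists_prod_eq_one fun i => by
      cases i using Fin.cases with
      | zero => exact ha
      | succ i => exact hv _
    obtain ⟨B, C, hB, hC, hBC⟩ := hhorn.exists_mul (hv 0) (hv 1) ha
    obtain ⟨U, V, hU, hUdet, hV, hVdet, hUV⟩ := hBC.exists_special_unitary (hAz 0)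
    refine ⟨Fin.cons (U * B) (Fin.cons (C * V) fun i => A i.succ), ?_, fun i => ?_⟩
    · rw [List.ofFn_succ, List.prod_cons] at hA
      simp only [List.ofFn_succ, List.prod_cons, Fin.cons_zero, Fin.cons_succ, ← mul_assoc]
      rw [← hA, hUV]
      simp only [mul_assoc]
    · cases i using Fin.cases with
      | zero => exact hB.unitary_mul hU hUdet
      | succ i => cases i using Fin.cases with
        | zero => exact hC.mul_unitary hV hVdet
        | succ i => exact hAz i.succ

end Realization

end SingularValuesA2

/-- Singular-values-of-a-product problem for `SL(3, ℂ)` (root system `A₂`),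
arbitrary number of factors: the prescribed decreasing trace-free log singular
value vectors `(aᵢ, bᵢ, cᵢ)` are realized by matrices `A₁, …, Aₙ ∈ SL(3, ℂ)`
with `A₁·…·Aₙ = 1` iff the stability inequalities (I)-(IV) hold. -/
theorem singular_values_of_product_A2
    (n : ℕ) (hn : 3 ≤ n) (a b c : Fin n → ℝ)
    (hab : ∀ i, b i ≤ a i) (hbc : ∀ i, c i ≤ b i)
    (hsum : ∀ i, a i + b i + c i = 0) :
    (∃ A : Fin n → Matrix (Fin 3) (Fin 3) ℂ,
        (List.ofFn A).prod = 1 ∧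
        ∀ i, (A i).det = 1 ∧
          ∃ h : (A i * (A i)ᴴ).IsHermitian,
          ∃ σ : Equiv.Perm (Fin 3),
            ∀ j, h.eigenvalues (σ j) =
              ![Real.exp (2 * a i), Real.exp (2 * b i), Real.exp (2 * c i)] j) ↔
    ((∀ i, a i + ∑ j ∈ univ.erase i, c j ≤ 0) ∧
     (∀ i j, i ≠ j → b i + b j + ∑ k ∈ (univ.erase i).erase j, c k ≤ 0) ∧
     (∀ i, 0 ≤ c i + ∑ j ∈ univ.erase i, a j) ∧
     (∀ i j, i ≠ j → 0 ≤ b i + b j + ∑ k ∈ (univ.erase i).erase j, a k)) := by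
  have h1 : ∀ (f : Fin n → ℝ) i, ∑ j ∈ univ.erase i, f j = ∑ j, f j - f i := fun f i => by
    rw [← Finset.sum_erase_add _ _ (Finset.mem_univ i), add_sub_cancel_right]
  have h2 : ∀ (f : Fin n → ℝ) i j, i ≠ j →
      ∑ k ∈ (univ.erase i).erase j, f k = ∑ k, f k - f i - f j := fun f i j hij => by
    rw [← h1, ← Finset.sum_erase_add _ _ (Finset.mem_erase.2 ⟨hij.symm, Finset.mem_univ j⟩),
      add_sub_cancel_right]
  simp only [← SingularValuesA2.hasSquaredSingularValues_iff]
  constructor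
  · rintro ⟨A, hA, hz⟩
    have h := SingularValuesA2.stabilityIneqs_of_prod_eq_one hab hbc hA hz
    refine ⟨fun i => ?_, fun i j hij => ?_, fun i => ?_, fun i j hij => ?_⟩
    · linarith [h1 c i, h.top i]
    · linarith [h2 c i j hij, h.mid i j hij]
    · linarith [h1 a i, h.bot i]
    · linarith [h2 a i j hij, h.mid' i j hij]
  · rintro ⟨i1, i2, i3, i4⟩
    obtain ⟨n, rfl⟩ : ∃ k, n = k + 1 := ⟨n - 1, by lia⟩
    have h : SingularValuesA2.IsStable fun i => ![a i, b i, c i] := by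
      refine ⟨fun i => ?_, fun i j hij => ?_, fun i => ?_, fun i j hij => ?_⟩
      · change a i - c i + ∑ j, c j ≤ 0
        linarith [h1 c i, i1 i]
      · change (b i - c i) + (b j - c j) + ∑ k, c k ≤ 0
        linarith [h2 c i j hij, i2 i j hij]
      · change 0 ≤ c i - a i + ∑ j, a j
        linarith [h1 a i, i3 i]
      · change 0 ≤ (b i - a i) + (b j - a j) + ∑ k, a k
        linarith [h2 a i j hij, i4 i j hij]
    obtain ⟨A, hA, hz⟩ := h.exists_prod_eq_one fun i => ⟨hab i, hbc i, hsum i⟩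
    refine ⟨A, hA, fun i => ?_⟩
    convert hz i using 1
    ext k
    fin_cases k <;> rfl
end

section
/- Weak stability inequalities in geometric (convex-hull) form, singular-value instance: Let A and B be invertible m×m complex matrices, and for g ∈ GL(m,ℂ) let log s(g) = (log s₁(g) ≥ … ≥ log sₘ(g)) ∈ ℝᵐ denote the logarithms of the singular values of g listed in decreasing order. Then log s(A·B) − log s(A) lies in the convex hull of the set {(log s_{σ(1)}(B), …, log s_{σ(m)}(B)) : σ a permutation of {1,…,m}}; i.e. log s(AB) ∈ log s(A) + conv(S_m · log s(B)). -/
open Matrix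
open scoped ComplexOrder

section QuadraticForm

variable {ι E : Type*} [Fintype ι] [NormedAddCommGroup E] [InnerProductSpace ℂ E]

/-- The quadratic form of an operator which is diagonal in an orthonormal basis. -/
lemma re_inner_apply_eq_sum_of_orthonormal_eigenbasis (u : OrthonormalBasis ι ℂ E) (T : E →ₗ[ℂ] E)
    (α : ι → ℝ) (hT : ∀ j, T (u j) = (α j : ℂ) • u j) (x : E) :
    (inner ℂ x (T x)).re = ∑ j, α j * ‖inner ℂ (u j) x‖ ^ 2 := by
  have hTx : T x = ∑ j, (inner ℂ (u j) x * (α j : ℂ)) • u j := by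
    conv_lhs => rw [← u.sum_repr' x]
    simp only [map_sum, map_smul, hT, smul_smul]
  rw [hTx, inner_sum, Complex.re_sum]
  refine Finset.sum_congr rfl fun j _ => ?_
  rw [inner_smul_right, ← inner_conj_symm x (u j)]
  have : inner ℂ (u j) x * (α j : ℂ) * (starRingEnd ℂ) (inner ℂ (u j) x)
      = ((α j * ‖inner ℂ (u j) x‖ ^ 2 : ℝ) : ℂ) := by
    push_cast
    rw [← Complex.mul_conj']
    ring
  rw [this, Complex.ofReal_re]

/-- Weyl monotonicity: ordered eigenvalues are monotone in the quadratic form. -/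
lemma eigenvalue_le_of_re_inner_le [LinearOrder ι] (u v : OrthonormalBasis ι ℂ E)
    (T S : E →ₗ[ℂ] E) {α β : ι → ℝ} (hα : Antitone α) (hβ : Antitone β)
    (hT : ∀ j, T (u j) = (α j : ℂ) • u j) (hS : ∀ j, S (v j) = (β j : ℂ) • v j)
    (h : ∀ x, (inner ℂ x (T x)).re ≤ (inner ℂ x (S x)).re) (i : ι) : α i ≤ β i := by
  classical
  have : FiniteDimensional ℂ E := u.toBasis.finiteDimensional_of_finite
  let f : E →ₗ[ℂ] ({j // j ≠ i} → ℂ) := LinearMap.pi fun j =>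
    (innerSL ℂ (if i < j.1 then u j.1 else v j.1)).toLinearMap
  have hf : LinearMap.ker f ≠ ⊥ := by
    apply LinearMap.ker_ne_bot_of_finrank_lt
    rw [Module.finrank_fintype_fun_eq_card, Module.finrank_eq_card_basis u.toBasis]
    exact Fintype.card_subtype_lt (x := i) (by simp)
  obtain ⟨x, hx, hx0⟩ := Submodule.exists_mem_ne_zero_of_ne_bot hf
  have hfx : ∀ j, j ≠ i → inner ℂ (if i < j then u j else v j) x = 0 := fun j hj =>
    congrFun (LinearMap.mem_ker.1 hx) ⟨j, hj⟩
  have hlow : α i * ‖x‖ ^ 2 ≤ (inner ℂ x (T x)).re := by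
    rw [re_inner_apply_eq_sum_of_orthonormal_eigenbasis u T α hT, ← u.sum_sq_norm_inner_right x,
      Finset.mul_sum]
    refine Finset.sum_le_sum fun j _ => ?_
    rcases le_or_gt j i with hj | hj
    · exact mul_le_mul_of_nonneg_right (hα hj) (by positivity)
    · have := hfx j hj.ne'
      rw [if_pos hj] at this
      simp [this]
  have hupp : (inner ℂ x (S x)).re ≤ β i * ‖x‖ ^ 2 := by
    rw [re_inner_apply_eq_sum_of_orthonormal_eigenbasis v S β hS, ← v.sum_sq_norm_inner_right x,
      Finset.mul_sum]
    refine Finset.sum_le_sum fun j _ => ?_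
    rcases le_or_gt i j with hj | hj
    · exact mul_le_mul_of_nonneg_right (hβ hj) (by positivity)
    · have := hfx j hj.ne
      rw [if_neg hj.not_gt] at this
      simp [this]
  have hpos : 0 < ‖x‖ ^ 2 := by positivity
  exact le_of_mul_le_mul_right (hlow.trans ((h x).trans hupp)) hpos

end QuadraticForm

section Matrices

variable {n : Type*} [Fintype n] [DecidableEq n]

lemma Matrix.PosSemidef.eigenvalue_le [LinearOrder n] {M N : Matrix n n ℂ}
    (h : (N - M).PosSemidef)
    (u v : OrthonormalBasis n ℂ (EuclideanSpace ℂ n)) {α β : n → ℝ}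
    (hα : Antitone α) (hβ : Antitone β)
    (hM : ∀ j, toEuclideanLin M (u j) = (α j : ℂ) • u j)
    (hN : ∀ j, toEuclideanLin N (v j) = (β j : ℂ) • v j) (i : n) : α i ≤ β i := by
  refine eigenvalue_le_of_re_inner_le u v _ _ hα hβ hM hN (fun x => ?_) i
  have h1 := (Complex.le_def.1 (h.dotProduct_mulVec_nonneg x.ofLp)).1
  have h2 : ∀ K : Matrix n n ℂ,
      inner ℂ x (toEuclideanLin K x) = star x.ofLp ⬝ᵥ (K *ᵥ x.ofLp) := fun K => by
    rw [EuclideanSpace.inner_eq_star_dotProduct, dotProduct_comm]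
    rfl
  rw [sub_mulVec, dotProduct_sub, Complex.sub_re] at h1
  rw [h2, h2]
  simpa using h1

/-- An orthonormal eigenbasis of a Hermitian matrix for a permutation of its eigenvalues. -/
lemma Matrix.IsHermitian.exists_eigenbasis_of_perm {M : Matrix n n ℂ} (h : M.IsHermitian)
    (σ : Equiv.Perm n) :
    ∃ u : OrthonormalBasis n ℂ (EuclideanSpace ℂ n),
      ∀ j, toEuclideanLin M (u j) = (h.eigenvalues (σ j) : ℂ) • u j := by
  refine ⟨h.eigenvectorBasis.reindex σ.symm, fun j => ?_⟩
  ext k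
  have := congrFun (h.mulVec_eigenvectorBasis (σ j)) k
  simpa using this

/-- Raising all eigenvalues of a Hermitian matrix to at least `t`. -/
lemma Matrix.IsHermitian.exists_max_eigenvalues {Q : Matrix n n ℂ} (h : Q.IsHermitian) (t : ℝ) :
    ∃ Q' : Matrix n n ℂ, (Q' - Q).PosSemidef ∧ (Q' - (t : ℂ) • 1).PosSemidef ∧
      Q'.det = ((∏ i, max (h.eigenvalues i) t : ℝ) : ℂ) := by
  let U : Matrix n n ℂ := h.eigenvectorUnitary
  have hU : U * Uᴴ = 1 := Unitary.coe_mul_star_self h.eigenvectorUnitary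
  have hQ : Q = U * diagonal (fun i => (h.eigenvalues i : ℂ)) * Uᴴ := h.spectral_theorem
  have ht : (t : ℂ) • (1 : Matrix n n ℂ) = U * diagonal (fun _ => (t : ℂ)) * Uᴴ := by
    rw [← smul_one_eq_diagonal]
    simp [hU]
  have key : ∀ d e : n → ℝ, (∀ i, e i ≤ d i) →
      (U * diagonal (fun i => (d i : ℂ)) * Uᴴ
        - U * diagonal (fun i => (e i : ℂ)) * Uᴴ).PosSemidef := by
    intro d e hde
    rw [← sub_mul, ← mul_sub, diagonal_sub]
    refine PosSemidef.mul_mul_conjTranspose_same (PosSemidef.diagonal fun i => ?_) U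
    rw [← Complex.ofReal_sub]
    exact Complex.zero_le_real.2 (sub_nonneg.2 (hde i))
  refine ⟨U * diagonal (fun i => ((max (h.eigenvalues i) t : ℝ) : ℂ)) * Uᴴ, ?_, ?_, ?_⟩
  · nth_rw 2 [hQ]
    exact key _ _ fun i => le_max_left _ _
  · rw [ht]
    exact key _ (fun _ => t) fun i => le_max_right _ _
  · rw [det_mul_right_comm, hU, one_mul, det_diagonal]
    push_cast
    rfl

end Matrices

section Majorization

/-- Abel summation inequality. -/
lemma mul_sum_le_sum_mul_of_antitone {m : ℕ} (w z : Fin m → ℝ) (hw : Antitone w)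
    (hz : ∀ k, 0 ≤ ∑ j ∈ Finset.Iic k, z j) (t : ℝ) (ht : ∀ i, t ≤ w i) :
    t * ∑ j, z j ≤ ∑ j, w j * z j := by
  induction m generalizing t with
  | zero => simp
  | succ m ih =>
    have h1 := ih (w ∘ Fin.castSucc) (z ∘ Fin.castSucc)
      (hw.comp_monotone Fin.strictMono_castSucc.monotone)
      (fun k => by
        have := hz k.castSucc
        rwa [← Fin.map_castSuccEmb_Iic, Finset.sum_map] at this)
      (w (Fin.last m)) (fun i => hw (Fin.le_last _))
    have h2 : 0 ≤ ∑ j, z j := by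
      have := hz (Fin.last m)
      rwa [show Finset.Iic (Fin.last m) = Finset.univ by ext i; simp [Fin.le_last]] at this
    have h3 := mul_le_mul_of_nonneg_right (ht (Fin.last m)) h2
    rw [Fin.sum_univ_castSucc] at h3 ⊢
    rw [Fin.sum_univ_castSucc]
    simp only [Function.comp_apply] at h1
    linarith

/-- A vector majorized by `b` lies in the convex hull of the permutations of `b` (Rado), with
majorization expressed through the sums of positive parts `max (b i - s) 0`. -/
lemma mem_convexHull_perm_of_sum_le {m : ℕ} (x b : Fin m → ℝ) (hb : Antitone b)
    (hsum : ∑ i, x i = ∑ i, b i)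
    (h : ∀ (S : Finset (Fin m)) (s : ℝ), ∑ i ∈ S, (x i - s) ≤ ∑ i, max (b i - s) 0) :
    x ∈ convexHull ℝ {y : Fin m → ℝ | ∃ σ : Equiv.Perm (Fin m), y = b ∘ σ} := by
  by_contra hx
  have hfin : {y : Fin m → ℝ | ∃ σ : Equiv.Perm (Fin m), y = b ∘ σ}.Finite :=
    (Set.finite_range fun σ : Equiv.Perm (Fin m) => b ∘ σ).subset
      fun y ⟨σ, hσ⟩ => ⟨σ, hσ.symm⟩
  obtain ⟨f, r, hf, hr⟩ := geometric_hahn_banach_closed_point (convex_convexHull ℝ _)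
    (hfin.isClosed_convexHull ℝ) hx
  let w : Fin m → ℝ := fun i => f (Pi.single i 1)
  have hfw : ∀ y, f y = ∑ i, w i * y i := fun y => by
    conv_lhs => rw [pi_eq_sum_univ' y]
    simp [w, map_sum, mul_comm, Pi.single]
  let τ := Tuple.sort (-w)
  have hτ : Antitone (w ∘ τ) := fun i j hij => by
    simpa using Tuple.monotone_sort (-w) hij
  have hle : ∑ j, w (τ j) * x (τ j) ≤ ∑ j, w (τ j) * b j := by
    have hz : ∀ k, 0 ≤ ∑ j ∈ Finset.Iic k, (b j - x (τ j)) := fun k => by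
      have h1 := h ((Finset.Iic k).map τ.toEmbedding) (b k)
      have h2 : ∑ i, max (b i - b k) 0 = ∑ j ∈ Finset.Iic k, (b j - b k) := by
        rw [← Finset.sum_subset (Finset.subset_univ (Finset.Iic k))]
        · exact Finset.sum_congr rfl fun j hj =>
            max_eq_left (sub_nonneg.2 (hb (Finset.mem_Iic.1 hj)))
        · intro j _ hj
          rw [Finset.mem_Iic, not_le] at hj
          exact max_eq_right (sub_nonpos.2 (hb hj.le))
      rw [Finset.sum_map, h2] at h1
      simp only [Finset.sum_sub_distrib, Equiv.coe_toEmbedding] at h1 ⊢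
      linarith
    have htot : ∑ j, (b j - x (τ j)) = 0 := by
      rw [Finset.sum_sub_distrib, Equiv.sum_comp τ x, hsum, sub_self]
    have h3 := mul_sum_le_sum_mul_of_antitone (w ∘ τ) _ hτ hz (-∑ i, |w i|) fun i =>
      (neg_le_neg (Finset.single_le_sum (f := fun i => |w i|) (fun _ _ => abs_nonneg _)
        (Finset.mem_univ (τ i)))).trans (neg_abs_le _)
    rw [htot, mul_zero] at h3
    simp only [mul_sub, Finset.sum_sub_distrib, Function.comp_apply] at h3
    linarith
  have h4 := hf (b ∘ τ.symm) (subset_convexHull ℝ _ ⟨τ.symm, rfl⟩)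
  rw [hfw, ← Equiv.sum_comp τ] at h4 hr
  simp only [Function.comp_apply, Equiv.symm_apply_apply] at h4
  linarith

end Majorization

lemma sum_log_eq_of_eigenvalues {m : ℕ} {M : Matrix (Fin m) (Fin m) ℂ} {d : Fin m → ℝ}
    (hd : ∃ h : M.IsHermitian, ∃ σ : Equiv.Perm (Fin m),
      ∀ j, h.eigenvalues (σ j) = Real.exp (2 * d j)) :
    M.det = (Real.exp (2 * ∑ j, d j) : ℂ) := by
  obtain ⟨h, σ, hσ⟩ := hd
  rw [h.det_eq_prod_eigenvalues, ← Equiv.prod_comp σ, Finset.mul_sum, Real.exp_sum]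
  simp [hσ]

/-- Weak stability inequalities in convex-hull form, singular value instance:
if `a`, `b`, `c` are the decreasingly ordered logarithms of the singular
values of the invertible matrices `A`, `B` and `A·B` respectively (so that the
eigenvalues of `g·gᴴ` are the `exp(2·entry)`), then `c - a` lies in the convex
hull of the orbit of `b` under coordinate permutations. -/
theorem lidskii_wielandt_singular_values
    (m : ℕ) (A B : Matrix (Fin m) (Fin m) ℂ)
    (hA : IsUnit A.det) (hB : IsUnit B.det)
    (a b c : Fin m → ℝ)
    (ha : Antitone a) (hb : Antitone b) (hc : Antitone c)
    (hae : ∃ h : (A * Aᴴ).IsHermitian, ∃ σ : Equiv.Perm (Fin m),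
      ∀ j, h.eigenvalues (σ j) = Real.exp (2 * a j))
    (hbe : ∃ h : (B * Bᴴ).IsHermitian, ∃ σ : Equiv.Perm (Fin m),
      ∀ j, h.eigenvalues (σ j) = Real.exp (2 * b j))
    (hce : ∃ h : ((A * B) * (A * B)ᴴ).IsHermitian, ∃ σ : Equiv.Perm (Fin m),
      ∀ j, h.eigenvalues (σ j) = Real.exp (2 * c j)) :
    c - a ∈ convexHull ℝ {x : Fin m → ℝ | ∃ σ : Equiv.Perm (Fin m), x = b ∘ σ} := by
  have hdet (Q : Matrix (Fin m) (Fin m) ℂ) :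
      (A * Q * Aᴴ).det = (A * Aᴴ).det * Q.det := by
    simp only [det_mul]
    ring
  have hAB : (A * B) * (A * B)ᴴ = A * (B * Bᴴ) * Aᴴ := by
    simp only [conjTranspose_mul, Matrix.mul_assoc]
  have hdA := sum_log_eq_of_eigenvalues hae
  have hdB := sum_log_eq_of_eigenvalues hbe
  have hdC := sum_log_eq_of_eigenvalues hce
  refine mem_convexHull_perm_of_sum_le _ b hb ?_ fun S s => ?_
  · rw [hAB, hdet, hdA, hdB, ← Complex.ofReal_mul, ← Real.exp_add, Complex.ofReal_inj,
      Real.exp_eq_exp] at hdC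
    simp only [Pi.sub_apply, Finset.sum_sub_distrib]
    linarith
  obtain ⟨hHa, σa, hσa⟩ := hae
  obtain ⟨hHb, σb, hσb⟩ := hbe
  obtain ⟨hHc, σc, hσc⟩ := hce
  obtain ⟨u, hu⟩ := hHa.exists_eigenbasis_of_perm σa
  obtain ⟨v, hv⟩ := hHc.exists_eigenbasis_of_perm σc
  simp only [hσa] at hu
  simp only [hσc] at hv
  obtain ⟨Q, hQB, hQs, hQdet⟩ := hHb.exists_max_eigenvalues (Real.exp (2 * s))
  have hexp : ∀ {d : Fin m → ℝ}, Antitone d → Antitone fun j => Real.exp (2 * d j) :=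
    fun hd i j hij => Real.exp_le_exp.2 (by linarith [hd hij])
  have hPc : (A * Q * Aᴴ - (A * B) * (A * B)ᴴ).PosSemidef := by
    rw [hAB, ← sub_mul, ← mul_sub]
    exact hQB.mul_mul_conjTranspose_same A
  have hPa : (A * Q * Aᴴ - (Real.exp (2 * s) : ℂ) • (A * Aᴴ)).PosSemidef := by
    have := hQs.mul_mul_conjTranspose_same A
    rw [mul_sub, sub_mul] at this
    simpa using this
  have hHp : (A * Q * Aᴴ).IsHermitian := by
    have := hPc.isHermitian.add hHc
    rwa [sub_add_cancel] at this
  let σp := Tuple.sort (-hHp.eigenvalues)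
  have hq : Antitone (hHp.eigenvalues ∘ σp) := fun i j hij => by
    simpa using Tuple.monotone_sort (-hHp.eigenvalues) hij
  obtain ⟨z, hz⟩ := hHp.exists_eigenbasis_of_perm σp
  have hcq : ∀ i, Real.exp (2 * c i) ≤ hHp.eigenvalues (σp i) :=
    hPc.eigenvalue_le v z (hexp hc) hq hv hz
  have haq : ∀ i, Real.exp (2 * s) * Real.exp (2 * a i) ≤ hHp.eigenvalues (σp i) :=
    hPa.eigenvalue_le u z ((hexp ha).const_mul (Real.exp_pos _).le) hq
      (fun j => by
        rw [map_smul, LinearMap.smul_apply, hu, smul_smul]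
        push_cast
        rfl) hz
  have hpos : ∀ i, 0 < hHp.eigenvalues (σp i) := fun i => (Real.exp_pos _).trans_le (hcq i)
  obtain ⟨p, hp⟩ : ∃ p : Fin m → ℝ, ∀ i, hHp.eigenvalues (σp i) = Real.exp (2 * p i) :=
    ⟨fun i => Real.log (hHp.eigenvalues (σp i)) / 2, fun i => by
      rw [mul_div_cancel₀ _ two_ne_zero, Real.exp_log (hpos i)]⟩
  have hcp : ∀ i, c i ≤ p i := fun i => by
    have := hcq i
    rw [hp, Real.exp_le_exp] at this
    linarith
  have hap : ∀ i, s + a i ≤ p i := fun i => by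
    have := haq i
    rw [hp, ← Real.exp_add, Real.exp_le_exp] at this
    linarith
  have hsump : ∑ i, p i = ∑ i, a i + ∑ i, max (b i) s := by
    have h1 := sum_log_eq_of_eigenvalues ⟨hHp, σp, hp⟩
    have h2 : ∏ i, max (hHb.eigenvalues i) (Real.exp (2 * s))
        = Real.exp (2 * ∑ i, max (b i) s) := by
      rw [← Equiv.prod_comp σb, Finset.mul_sum, Real.exp_sum]
      refine Finset.prod_congr rfl fun i _ => ?_
      rw [hσb, mul_max_of_nonneg _ _ zero_le_two, Real.exp_monotone.map_max]
    rw [hdet, hdA, hQdet, h2, ← Complex.ofReal_mul, ← Real.exp_add, Complex.ofReal_inj,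
      Real.exp_eq_exp] at h1
    linarith
  calc ∑ i ∈ S, ((c - a) i - s) ≤ ∑ i ∈ S, (p i - a i - s) :=
        Finset.sum_le_sum fun i _ => by linarith [hcp i, Pi.sub_apply c a i]
    _ ≤ ∑ i, (p i - a i - s) :=
        Finset.sum_le_sum_of_subset_of_nonneg (Finset.subset_univ S)
          fun i _ _ => by linarith [hap i]
    _ = ∑ i, (max (b i) s - s) := by
        simp only [Finset.sum_sub_distrib, hsump]
        ring
    _ = ∑ i, max (b i - s) 0 := by simp only [← max_sub_sub_right, sub_self]
end
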